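/- arXiv:1506.08455 — 12 statements merged into one kernel-verified Lean document; each statement's English description precedes it below -/
import Mathlib

section
/- Let f : ℝ → ℂ be continuous and differentiable, with f, its derivative f', and the function x ↦ x·f(x) all square-integrable on ℝ. Then the function x ↦ |f(x)|² · log|f(x)|² (extended by the value 0 at points where f(x) = 0) is integrable on ℝ. In other words, W̃ ⊂ W(ℝ). -/
open MeasureTheory Filter Set Topology

/-- A differentiable function which is square-integrable along with its derivative is bounded. -/
theorem exists_norm_sq_le_of_integrable_deriv {E : Type*} [NormedAddCommGroup E]
    [InnerProductSpace ℝ E] [CompleteSpace E] {f : ℝ → E} (hdiff : Differentiable ℝ f)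
    (hf : Integrable (fun x => ‖f x‖ ^ 2)) (hf' : Integrable (fun x => ‖deriv f x‖ ^ 2)) :
    ∃ M : ℝ, ∀ x, ‖f x‖ ^ 2 ≤ M := by
  have hderiv (x : ℝ) : HasDerivAt (fun y => ‖f y‖ ^ 2) (2 * inner ℝ (f x) (deriv f x)) x :=
    (hdiff x).hasDerivAt.norm_sq
  have hint : Integrable (fun x => 2 * inner ℝ (f x) (deriv f x)) := by
    refine (hf.add hf').mono' ?_ (.of_forall fun x => ?_)
    · exact ((hdiff.continuous.aestronglyMeasurable.inner
        (stronglyMeasurable_deriv f).aestronglyMeasurable).const_mul 2)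
    · have h := abs_real_inner_le_norm (f x) (deriv f x)
      rw [Real.norm_eq_abs, abs_mul, abs_two, Pi.add_apply]
      nlinarith [sq_nonneg (‖f x‖ - ‖deriv f x‖)]
  refine ⟨‖f 0‖ ^ 2 + ∫ x, ‖2 * inner ℝ (f x) (deriv f x)‖, fun x => ?_⟩
  have hftc := intervalIntegral.integral_eq_sub_of_hasDerivAt (a := 0) (b := x)
    (fun y _ => hderiv y) hint.intervalIntegrable
  have hle := (intervalIntegral.norm_integral_le_integral_norm_uIoc (a := 0) (b := x)
    (f := fun x => 2 * inner ℝ (f x) (deriv f x)) (μ := volume)).trans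
    (setIntegral_le_integral hint.norm (.of_forall fun _ => norm_nonneg _))
  rw [hftc] at hle
  linarith [le_trans (le_abs_self _) hle]

theorem Real.abs_sq_mul_log_sq_le {r M : ℝ} (hr : 0 ≤ r) (hM : r ^ 2 ≤ M) :
    |r ^ 2 * Real.log (r ^ 2)| ≤ 2 * r + 2 * M * r ^ 2 := by
  have hM0 : 0 ≤ M := (sq_nonneg r).trans hM
  rw [Real.log_pow, Nat.cast_ofNat]
  rcases hr.eq_or_lt with rfl | hr0
  · simp
  rcases le_total r 1 with h1 | h1
  · have h := (Real.abs_log_mul_self_lt r hr0 h1).le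
    calc |r ^ 2 * (2 * Real.log r)| = 2 * r * |Real.log r * r| := by
          rw [show r ^ 2 * (2 * Real.log r) = 2 * r * (Real.log r * r) by ring, abs_mul,
            abs_of_nonneg (by positivity : 0 ≤ 2 * r)]
      _ ≤ 2 * r * 1 := by gcongr
      _ ≤ 2 * r + 2 * M * r ^ 2 := by nlinarith [mul_nonneg hM0 (sq_nonneg r)]
  · have hlog : Real.log r ≤ M := by nlinarith [Real.log_le_sub_one_of_pos hr0]
    rw [abs_of_nonneg (by have := Real.log_nonneg h1; positivity)]
    nlinarith [mul_le_mul_of_nonneg_left hlog (sq_nonneg r)]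

/-- If `f : ℝ → ℂ` is continuous and differentiable, with `f`, `f'`, and `x ↦ x·f(x)`
all square-integrable on `ℝ`, then `x ↦ |f(x)|² log|f(x)|²` is integrable on `ℝ`
(with the convention `Real.log 0 = 0`, so it vanishes where `f` vanishes).
In other words, `W̃ ⊂ W(ℝ)`. -/
theorem stmt1 (f : ℝ → ℂ)
    (hcont : Continuous f) (hdiff : Differentiable ℝ f)
    (hfL2 : Integrable (fun x => ‖f x‖ ^ 2))
    (hf'L2 : Integrable (fun x => ‖deriv f x‖ ^ 2))
    (hxfL2 : Integrable (fun x => ‖x • f x‖ ^ 2)) :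
    Integrable (fun x => ‖f x‖ ^ 2 * Real.log (‖f x‖ ^ 2)) := by
  obtain ⟨M, hM⟩ := exists_norm_sq_le_of_integrable_deriv hdiff hfL2 hf'L2
  refine (((hfL2.add hxfL2).add integrable_inv_one_add_sq).add (hfL2.const_mul (2 * M))).mono'
    ?_ (.of_forall fun x => ?_)
  · exact (hcont.norm.pow 2).aestronglyMeasurable.mul
      (Real.measurable_log.comp (hcont.norm.pow 2).measurable).aestronglyMeasurable
  · refine (Real.abs_sq_mul_log_sq_le (norm_nonneg (f x)) (hM x)).trans ?_
    simp only [Pi.add_apply, norm_smul, mul_pow, Real.norm_eq_abs, sq_abs]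
    gcongr
    have hw : 0 < 1 + x ^ 2 := by positivity
    have h : 0 ≤ (1 + x ^ 2)⁻¹ * (‖f x‖ * (1 + x ^ 2) - 1) ^ 2 := by positivity
    have e : (1 + x ^ 2)⁻¹ * (‖f x‖ * (1 + x ^ 2) - 1) ^ 2 =
        ‖f x‖ ^ 2 + x ^ 2 * ‖f x‖ ^ 2 + (1 + x ^ 2)⁻¹ - 2 * ‖f x‖ := by
      field_simp
      ring
    linarith
end

section
/- Let ω ∈ ℝ and γ ∈ ℝ with γ ≠ 0, and let φ_{ω,γ}(x) = e^{(ω+1)/2} · e^{-(|x|+γ/2)²/2}. Then φ_{ω,γ} is continuous on ℝ, twice continuously differentiable on ℝ\{0}, satisfies -φ_{ω,γ}''(x) + ω·φ_{ω,γ}(x) - φ_{ω,γ}(x)·log(φ_{ω,γ}(x)²) = 0 for every x ≠ 0, and its one-sided derivative limits at 0 exist and satisfy φ_{ω,γ}'(0⁺) - φ_{ω,γ}'(0⁻) = -γ·φ_{ω,γ}(0). -/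
open MeasureTheory Filter Set Topology

/-- Away from the origin, the sign function is locally constant. -/
theorem eventually_ne_and_sign_eq {x : ℝ} (hx : x ≠ 0) :
    ∀ᶠ y in 𝓝 x, y ≠ 0 ∧ Real.sign y = Real.sign x := by
  rcases hx.lt_or_gt with h | h
  · filter_upwards [Iio_mem_nhds h] with y hy
    exact ⟨ne_of_lt hy, by rw [Real.sign_of_neg hy, Real.sign_of_neg h]⟩
  · filter_upwards [Ioi_mem_nhds h] with y hy
    exact ⟨ne_of_gt hy, by rw [Real.sign_of_pos hy, Real.sign_of_pos h]⟩

theorem hasDerivAt_abs_sign {x : ℝ} (hx : x ≠ 0) :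
    HasDerivAt (fun y : ℝ => |y|) (Real.sign x) x := by
  rcases hx.lt_or_gt with h | h
  · rw [Real.sign_of_neg h]; exact hasDerivAt_abs_neg h
  · rw [Real.sign_of_pos h]; exact hasDerivAt_abs_pos h

theorem hasDerivAt_gaussian_abs (C a : ℝ) {x : ℝ} (hx : x ≠ 0) :
    HasDerivAt (fun y : ℝ => C * Real.exp (-(|y| + a) ^ 2 / 2))
      (-(|x| + a) * Real.sign x * (C * Real.exp (-(|x| + a) ^ 2 / 2))) x := by
  have h := (((((hasDerivAt_abs_sign hx).add_const a).pow 2).neg.div_const 2).exp).const_mul C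
  refine h.congr_deriv ?_
  simp
  ring

/-- The peak-Gausson profile `φ_{ω,γ}(x) = e^{(ω+1)/2} e^{-(|x|+γ/2)²/2}` is continuous on `ℝ`,
twice continuously differentiable on `ℝ \ {0}`, satisfies the stationary NLS-log equation
`-φ'' + ωφ - φ log(φ²) = 0` for `x ≠ 0`, and its one-sided derivative limits at `0` exist and
satisfy the jump condition `φ'(0⁺) - φ'(0⁻) = -γ φ(0)`. -/
theorem stmt2 (ω γ : ℝ) (hγ : γ ≠ 0) (φ : ℝ → ℝ)
    (hφ : ∀ x, φ x = Real.exp ((ω + 1) / 2) * Real.exp (-(|x| + γ / 2) ^ 2 / 2)) :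
    Continuous φ ∧
    ContDiffOn ℝ 2 φ {0}ᶜ ∧
    (∀ x ≠ 0, -(deriv (deriv φ) x) + ω * φ x - φ x * Real.log (φ x ^ 2) = 0) ∧
    (∃ Lp Lm : ℝ,
      Tendsto (deriv φ) (𝓝[>] (0 : ℝ)) (𝓝 Lp) ∧
      Tendsto (deriv φ) (𝓝[<] (0 : ℝ)) (𝓝 Lm) ∧
      Lp - Lm = -γ * φ 0) := by
  have hφ' : φ = fun x =>
      Real.exp ((ω + 1) / 2) * Real.exp (-(|x| + γ / 2) ^ 2 / 2) := funext hφ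
  have hcont : Continuous φ := by rw [hφ']; fun_prop
  have hd : ∀ x ≠ 0, HasDerivAt φ (-(|x| + γ / 2) * Real.sign x * φ x) x := by
    intro x hx
    rw [hφ']
    exact hasDerivAt_gaussian_abs _ _ hx
  refine ⟨hcont, ?_, ?_, -(γ / 2) * φ 0, γ / 2 * φ 0, ?_, ?_, by ring⟩
  · intro x hx
    have habs : ContDiffAt ℝ 2 (fun y : ℝ => |y|) x := contDiffAt_abs hx
    rw [hφ']
    exact (contDiffAt_const.mul
      (((habs.add contDiffAt_const).pow 2).neg.div_const 2).exp).contDiffWithinAt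
  · intro x hx
    have heq : deriv φ =ᶠ[𝓝 x] fun y => -(|y| + γ / 2) * Real.sign x * φ y := by
      filter_upwards [eventually_ne_and_sign_eq hx] with y hy
      rw [(hd y hy.1).deriv, hy.2]
    have h2 := ((((hasDerivAt_abs_sign hx).add_const (γ / 2)).neg.mul_const
      (Real.sign x)).mul (hd x hx)).deriv
    have hlog : Real.log (φ x ^ 2) = ω + 1 - (|x| + γ / 2) ^ 2 := by
      rw [hφ, ← Real.exp_add, ← Real.exp_nat_mul, Real.log_exp]
      push_cast
      ring
    have hs : Real.sign x ^ 2 = 1 := by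
      rcases Real.sign_apply_eq_of_ne_zero x hx with h | h <;> simp [h]
    rw [heq.deriv_eq, hlog]
    refine (congrArg (fun d => -d + ω * φ x - φ x * (ω + 1 - (|x| + γ / 2) ^ 2)) h2).trans ?_
    simp only [Pi.neg_apply]
    linear_combination (φ x - (|x| + γ / 2) ^ 2 * φ x) * hs
  · have hc : Tendsto (fun x => -(|x| + γ / 2) * φ x) (𝓝[>] 0) (𝓝 (-(γ / 2) * φ 0)) := by
      have h : Continuous fun x => -(|x| + γ / 2) * φ x := by fun_prop
      simpa using (h.tendsto 0).mono_left nhdsWithin_le_nhds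
    refine hc.congr' ?_
    filter_upwards [self_mem_nhdsWithin] with x hx
    rw [(hd x (ne_of_gt hx)).deriv, Real.sign_of_pos hx, mul_one]
  · have hc : Tendsto (fun x => (|x| + γ / 2) * φ x) (𝓝[<] 0) (𝓝 (γ / 2 * φ 0)) := by
      have h : Continuous fun x => (|x| + γ / 2) * φ x := by fun_prop
      simpa using (h.tendsto 0).mono_left nhdsWithin_le_nhds
    refine hc.congr' ?_
    filter_upwards [self_mem_nhdsWithin] with x hx
    rw [(hd x (ne_of_lt hx)).deriv, Real.sign_of_neg hx]
    ring
end

section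
/- Let ω ∈ ℝ and γ ∈ ℝ with γ ≠ 0. Suppose φ : ℝ → ℂ is not identically zero, is continuous on ℝ, twice continuously differentiable on ℝ\{0}, and that φ, φ' are square-integrable on ℝ and φ'' is square-integrable on ℝ\{0}; suppose moreover that φ(x) → 0 and φ'(x) → 0 as |x| → ∞, that the one-sided limits φ'(0⁺), φ'(0⁻) exist and satisfy φ'(0⁺) - φ'(0⁻) = -γφ(0), and that -φ''(x) + ωφ(x) = φ(x)·log|φ(x)|² for every x ≠ 0 (with the convention φ(x)·log|φ(x)|² = 0 when φ(x) = 0). Then there exists θ ∈ ℝ such that φ(x) = e^{iθ} · e^{(ω+1)/2} · e^{-(|x|+γ/2)²/2} for all x ∈ ℝ. -/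
open MeasureTheory Filter Set Topology

/-- The derivative of `‖f‖² log ‖f‖²`, valid also at the zeros of `f`. -/
theorem hasDerivAt_norm_sq_mul_log {f : ℝ → ℂ} {f' : ℂ} {x : ℝ} (hf : HasDerivAt f f' x) :
    HasDerivAt (fun y => ‖f y‖ ^ 2 * Real.log (‖f y‖ ^ 2))
      (2 * inner ℝ (f x) f' * (Real.log (‖f x‖ ^ 2) + 1)) x := by
  by_cases h0 : f x = 0
  · have hO : (fun y => ‖f y‖) =O[𝓝 x] fun y => y - x := by
      simpa [h0] using hf.isBigO_sub.norm_left
    have hlog : Tendsto (fun y => 2 * (‖f y‖ * Real.log ‖f y‖)) (𝓝 x) (𝓝 0) := by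
      have h : ContinuousAt (fun y => 2 * (‖f y‖ * Real.log ‖f y‖)) x :=
        (Real.continuous_mul_log.continuousAt.comp hf.continuousAt.norm).const_mul 2
      simpa [ContinuousAt, h0] using h
    have h := ((Asymptotics.isLittleO_one_iff ℝ).2 hlog).mul_isBigO hO
    rw [hasDerivAt_iff_isLittleO]
    refine h.congr (fun y => ?_) (fun y => ?_)
    · simp [h0, Real.log_pow]
      ring
    · simp
  · have hn : ‖f x‖ ^ 2 ≠ 0 := by simpa using h0
    refine (hf.norm_sq.mul (hf.norm_sq.log hn)).congr_deriv ?_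
    field_simp

/-- A function with vanishing derivative on `(0, ∞)` which tends to zero at infinity vanishes
on `(0, ∞)`. -/
theorem eq_zero_of_hasDerivAt_zero_of_tendsto {E : Type*} [NormedAddCommGroup E]
    [NormedSpace ℝ E] {F : ℝ → E} (hF : ∀ x > 0, HasDerivAt F 0 x)
    (hlim : Tendsto F atTop (𝓝 0)) {x : ℝ} (hx : 0 < x) : F x = 0 := by
  have hconst : ∀ y ∈ Ioi (0 : ℝ), F y = F x := fun y hy =>
    isOpen_Ioi.is_const_of_deriv_eq_zero isPreconnected_Ioi
      (fun z hz => (hF z hz).differentiableAt.differentiableWithinAt)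
      (fun z hz => (hF z hz).deriv) hy hx
  refine tendsto_nhds_unique (tendsto_const_nhds.congr' ?_) hlim
  filter_upwards [eventually_gt_atTop 0] with y hy using (hconst y hy).symm

/-- First integral of the logarithmic NLS profile equation for decaying solutions on `(0, ∞)`,
combining conservation of energy and of angular momentum. -/
theorem sq_deriv_eq_of_logNLS {ω : ℝ} {f g : ℝ → ℂ} (hf : ∀ x > 0, HasDerivAt f (g x) x)
    (hg : ∀ x > 0, HasDerivAt g ((ω - Real.log (‖f x‖ ^ 2)) • f x) x)
    (hf0 : Tendsto f atTop (𝓝 0)) (hg0 : Tendsto g atTop (𝓝 0)) {x : ℝ} (hx : 0 < x) :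
    ‖g x‖ ^ 2 = ‖f x‖ ^ 2 * (ω + 1 - Real.log (‖f x‖ ^ 2)) ∧
    g x ^ 2 = f x ^ 2 * ((ω + 1 - Real.log (‖f x‖ ^ 2) : ℝ) : ℂ) := by
  have henergy : ‖g x‖ ^ 2 = ‖f x‖ ^ 2 * (ω + 1 - Real.log (‖f x‖ ^ 2)) := by
    have h := eq_zero_of_hasDerivAt_zero_of_tendsto
      (F := fun y => ‖g y‖ ^ 2 - (ω + 1) * ‖f y‖ ^ 2 + ‖f y‖ ^ 2 * Real.log (‖f y‖ ^ 2))
      (fun y hy => by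
        refine (((hg y hy).norm_sq.sub ((hf y hy).norm_sq.const_mul (ω + 1))).add
          (hasDerivAt_norm_sq_mul_log (hf y hy))).congr_deriv ?_
        rw [inner_smul_right, real_inner_comm (f y) (g y)]
        ring)
      (by
        have hn : Tendsto (fun y => ‖f y‖ ^ 2) atTop (𝓝 0) := by
          simpa using hf0.norm.pow 2
        have hl : Tendsto (fun y => ‖f y‖ ^ 2 * Real.log (‖f y‖ ^ 2)) atTop (𝓝 0) := by
          simpa [Function.comp_def] using (Real.continuous_mul_log.tendsto 0).comp hn
        simpa using ((hg0.norm.pow 2).sub (hn.const_mul (ω + 1))).add hl) hx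
    linarith
  have hmomentum : star (f x) * g x - f x * star (g x) = 0 :=
    eq_zero_of_hasDerivAt_zero_of_tendsto
      (F := fun y => star (f y) * g y - f y * star (g y))
      (fun y hy => by
        refine (((hf y hy).star.mul (hg y hy)).sub ((hf y hy).mul (hg y hy).star)).congr_deriv ?_
        simp only [Complex.real_smul, star_mul, Complex.star_def, Complex.conj_ofReal]
        ring)
      (by simpa using (hf0.star.mul hg0).sub (hf0.mul hg0.star)) hx
  refine ⟨henergy, ?_⟩
  by_cases h0 : f x = 0
  · have : g x = 0 := by simpa [h0] using henergy
    simp [h0, this]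
  · have hs : star (f x) ≠ 0 := by simpa using h0
    have hff : f x * star (f x) = ((‖f x‖ ^ 2 : ℝ) : ℂ) := by
      simpa using Complex.mul_conj' (f x)
    have hgg : g x * star (g x) = ((‖g x‖ ^ 2 : ℝ) : ℂ) := by
      simpa using Complex.mul_conj' (g x)
    rw [henergy, Complex.ofReal_mul, ← hff] at hgg
    apply mul_right_cancel₀ hs
    linear_combination g x * hmomentum + f x * hgg

/-- A decaying nontrivial solution of the logarithmic NLS profile equation on `(0, ∞)` is a
translated Gausson. -/
theorem exists_eq_gausson_of_logNLS {ω : ℝ} {f g : ℝ → ℂ} (hf : ∀ x > 0, HasDerivAt f (g x) x)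
    (hg : ∀ x > 0, HasDerivAt g ((ω - Real.log (‖f x‖ ^ 2)) • f x) x)
    (hf0 : Tendsto f atTop (𝓝 0)) (hg0 : Tendsto g atTop (𝓝 0)) {x₀ : ℝ} (hx₀ : 0 < x₀)
    (hne : f x₀ ≠ 0) :
    ∃ (A : ℂ) (c : ℝ), ‖A‖ = Real.exp ((ω + 1) / 2) ∧
      ∀ x > 0, f x = A * (Real.exp (-(x - c) ^ 2 / 2) : ℂ) ∧ g x = ((c - x : ℝ) : ℂ) * f x := by
  have hsq := fun {x : ℝ} (hx : 0 < x) => sq_deriv_eq_of_logNLS hf hg hf0 hg0 hx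
  -- The logarithmic derivative `g / f` has slope `-1` wherever `f` does not vanish.
  have hw : ∀ x > 0, f x ≠ 0 → HasDerivAt (fun y => g y / f y + (y : ℂ)) 0 x := by
    intro x hx h0
    refine (((hg x hx).div (hf x hx) h0).add Complex.ofRealCLM.hasDerivAt).congr_deriv ?_
    have h := (hsq hx).2
    push_cast at h
    simp only [Complex.real_smul, Complex.ofRealCLM_apply, Complex.ofReal_one]
    field_simp
    push_cast
    linear_combination -h
  have hreal : ∃ r : ℝ, g x₀ / f x₀ = r := by
    have h : (g x₀ / f x₀) ^ 2 = ((ω + 1 - Real.log (‖f x₀‖ ^ 2) : ℝ) : ℂ) := by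
      rw [div_pow, (hsq hx₀).2]
      field_simp
    have hpos : 0 ≤ ω + 1 - Real.log (‖f x₀‖ ^ 2) := by
      have h1 : 0 < ‖f x₀‖ ^ 2 := by positivity
      have h2 := (hsq hx₀).1 ▸ sq_nonneg ‖g x₀‖
      exact nonneg_of_mul_nonneg_right h2 h1
    rw [← Real.sq_sqrt hpos, Complex.ofReal_pow, sq_eq_sq_iff_eq_or_eq_neg] at h
    rcases h with h | h
    · exact ⟨_, h⟩
    · exact ⟨_, h.trans (Complex.ofReal_neg _).symm⟩
  obtain ⟨r, hr⟩ := hreal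
  set c : ℝ := r + x₀ with hc
  set A : ℂ := f x₀ * (Real.exp ((x₀ - c) ^ 2 / 2) : ℂ) with hA
  have hexp : ∀ y : ℝ, ((Real.exp ((y - c) ^ 2 / 2) : ℝ) : ℂ) *
      (Real.exp (-(y - c) ^ 2 / 2) : ℂ) = 1 := by
    intro y
    rw [← Complex.ofReal_mul, ← Real.exp_add]
    simp [neg_div]
  have hA0 : A ≠ 0 := mul_ne_zero hne (by exact_mod_cast (Real.exp_pos _).ne')
  have hG : ∀ x, HasDerivAt (fun y : ℝ => ((Real.exp ((y - c) ^ 2 / 2) : ℝ) : ℂ))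
      ((Real.exp ((x - c) ^ 2 / 2) * (x - c) : ℝ) : ℂ) x := by
    intro x
    refine HasDerivAt.ofReal_comp ?_
    refine (((((hasDerivAt_id x).sub_const c).pow 2).div_const 2).exp).congr_deriv ?_
    simp
  let T : Set ℝ := {x | 0 < x ∧ f x = A * (Real.exp (-(x - c) ^ 2 / 2) : ℂ) ∧
    g x = ((c - x : ℝ) : ℂ) * f x}
  have hx₀T : x₀ ∈ T := by
    refine ⟨hx₀, ?_, ?_⟩
    · rw [hA, mul_assoc, hexp, mul_one]
    · rw [div_eq_iff hne] at hr
      rw [hr, hc]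
      simp
  have hTopen : IsOpen T := by
    rw [Metric.isOpen_iff]
    rintro x ⟨hx, hfx, hgx⟩
    have hfx0 : f x ≠ 0 := by
      rw [hfx]
      exact mul_ne_zero hA0 (by exact_mod_cast (Real.exp_pos _).ne')
    obtain ⟨ε, hε, hball⟩ := Metric.eventually_nhds_iff_ball.1
      ((eventually_gt_nhds hx).and ((hf x hx).continuousAt.eventually_ne hfx0))
    have hxε := Metric.mem_ball_self (x := x) hε
    refine ⟨ε, hε, fun y hy => ?_⟩
    have hconn := (convex_ball x ε).isPreconnected
    have hgball : ∀ z ∈ Metric.ball x ε, g z = ((c - z : ℝ) : ℂ) * f z := by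
      intro z hz
      have h := Metric.isOpen_ball.is_const_of_deriv_eq_zero hconn
        (fun z hz => (hw z (hball z hz).1 (hball z hz).2).differentiableAt.differentiableWithinAt)
        (fun z hz => (hw z (hball z hz).1 (hball z hz).2).deriv) hz hxε
      have hxc : g x / f x + (x : ℂ) = c := by
        rw [hgx, mul_div_cancel_right₀ _ hfx0]
        simp
      simp only [hxc] at h
      rw [← div_eq_iff (hball z hz).2, eq_sub_of_add_eq h, Complex.ofReal_sub]
    have hq : ∀ z ∈ Metric.ball x ε,
        HasDerivAt (fun y => f y * ((Real.exp ((y - c) ^ 2 / 2) : ℝ) : ℂ)) 0 z := by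
      intro z hz
      refine ((hf z (hball z hz).1).mul (hG z)).congr_deriv ?_
      rw [hgball z hz]
      push_cast
      ring
    have h := Metric.isOpen_ball.is_const_of_deriv_eq_zero hconn
      (fun z hz => (hq z hz).differentiableAt.differentiableWithinAt)
      (fun z hz => (hq z hz).deriv) hy hxε
    refine ⟨(hball y hy).1, ?_, hgball y hy⟩
    simp only [hfx] at h
    linear_combination (Real.exp (-(y - c) ^ 2 / 2) : ℂ) * h - f y * hexp y
      + A * (Real.exp (-(y - c) ^ 2 / 2) : ℂ) * hexp x
  have hTclosed : closure T ∩ Ioi 0 ⊆ T := by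
    rintro x ⟨hxT, hx⟩
    rw [mem_closure_iff_frequently] at hxT
    have hfc := (hf x hx).continuousAt
    have hgc := (hg x hx).continuousAt
    refine ⟨hx, ?_, ?_⟩
    · refine tendsto_nhds_unique_of_frequently_eq hfc.tendsto
        (ContinuousAt.tendsto (f := fun x : ℝ => A * (Real.exp (-(x - c) ^ 2 / 2) : ℂ)) ?_)
        (hxT.mono fun y hy => hy.2.1)
      fun_prop
    · refine tendsto_nhds_unique_of_frequently_eq hgc.tendsto
        (ContinuousAt.tendsto (f := fun x : ℝ => ((c - x : ℝ) : ℂ) * f x) ?_)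
        (hxT.mono fun y hy => hy.2.2)
      fun_prop
  have hall : Ioi 0 ⊆ T :=
    isPreconnected_Ioi.subset_of_closure_inter_subset hTopen ⟨x₀, hx₀, hx₀T⟩ hTclosed
  refine ⟨A, c, ?_, fun x hx => (hall hx).2⟩
  have h := (hsq hx₀).1
  have hn : 0 < ‖f x₀‖ := norm_pos_iff.2 hne
  rw [hx₀T.2.2, norm_mul, mul_pow, mul_comm] at h
  have h2 := mul_left_cancel₀ (by positivity) h
  rw [Complex.norm_real, Real.norm_eq_abs, sq_abs, Real.log_pow] at h2
  push_cast at h2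
  rw [hA, norm_mul, Complex.norm_real, Real.norm_eq_abs, Real.abs_exp,
    ← Real.exp_log hn, ← Real.exp_add]
  congr 1
  linarith

/-- One-sided boundary values at `0` of a translated Gausson and its derivative. -/
theorem gausson_limits_at_zero {f g : ℝ → ℂ} {a L A : ℂ} {c : ℝ}
    (hfa : Tendsto f (𝓝[>] 0) (𝓝 a)) (hgL : Tendsto g (𝓝[>] 0) (𝓝 L))
    (h : ∀ x > 0, f x = A * (Real.exp (-(x - c) ^ 2 / 2) : ℂ) ∧
      g x = ((c - x : ℝ) : ℂ) * f x) :
    a = A * (Real.exp (-c ^ 2 / 2) : ℂ) ∧ L = (c : ℂ) * a := by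
  constructor
  · have hG : Continuous fun x : ℝ => A * (Real.exp (-(x - c) ^ 2 / 2) : ℂ) := by fun_prop
    have h0 := (hG.tendsto 0).mono_left (nhdsWithin_le_nhds (s := Ioi 0))
    rw [zero_sub, neg_sq] at h0
    refine tendsto_nhds_unique hfa (h0.congr' ?_)
    filter_upwards [self_mem_nhdsWithin] with x hx using (h x hx).1.symm
  · have hl : Continuous fun x : ℝ => ((c - x : ℝ) : ℂ) := by fun_prop
    have h0 := ((hl.tendsto 0).mono_left (nhdsWithin_le_nhds (s := Ioi 0))).mul hfa
    rw [sub_zero] at h0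
    refine tendsto_nhds_unique hgL (h0.congr' ?_)
    filter_upwards [self_mem_nhdsWithin] with x hx using (h x hx).2.symm

/-- Uniqueness of the standing-wave profile for the NLS-log equation with δ-interaction:
any nontrivial solution of `-φ'' + ωφ = φ log|φ|²` on `ℝ \ {0}` which is continuous on `ℝ`,
`C²` on `ℝ \ {0}`, belongs to `H¹(ℝ) ∩ H²(ℝ \ {0})`, decays (together with its derivative)
at infinity, and satisfies the jump condition `φ'(0⁺) - φ'(0⁻) = -γφ(0)`, is of the form
`e^{iθ} e^{(ω+1)/2} e^{-(|x|+γ/2)²/2}` for some `θ ∈ ℝ`. -/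
theorem stmt3 (ω γ : ℝ) (hγ : γ ≠ 0) (φ : ℝ → ℂ)
    (hne : ∃ x, φ x ≠ 0)
    (hcont : Continuous φ)
    (hC2 : ContDiffOn ℝ 2 φ {0}ᶜ)
    (hφL2 : Integrable (fun x => ‖φ x‖ ^ 2))
    (hφ'L2 : Integrable (fun x => ‖deriv φ x‖ ^ 2))
    (hφ''L2 : IntegrableOn (fun x => ‖deriv (deriv φ) x‖ ^ 2) ({0}ᶜ))
    (hdecay : Tendsto φ (cocompact ℝ) (𝓝 0))
    (hdecay' : Tendsto (deriv φ) (cocompact ℝ) (𝓝 0))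
    (Lp Lm : ℂ)
    (hLp : Tendsto (deriv φ) (𝓝[>] (0 : ℝ)) (𝓝 Lp))
    (hLm : Tendsto (deriv φ) (𝓝[<] (0 : ℝ)) (𝓝 Lm))
    (hjump : Lp - Lm = -(γ : ℂ) * φ 0)
    (heq : ∀ x ≠ 0, -(deriv (deriv φ) x) + (ω : ℂ) * φ x
      = φ x * (Real.log (‖φ x‖ ^ 2) : ℂ)) :
    ∃ θ : ℝ, ∀ x : ℝ, φ x = Complex.exp (θ * Complex.I) *
      (Real.exp ((ω + 1) / 2) : ℂ) * (Real.exp (-(|x| + γ / 2) ^ 2 / 2) : ℂ) := by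
  have hd : ∀ x ≠ 0, HasDerivAt φ (deriv φ x) x := fun x hx =>
    ((hC2.differentiableOn (by norm_num)).differentiableAt
      (isOpen_compl_singleton.mem_nhds hx)).hasDerivAt
  have hd2 : ∀ x ≠ 0, HasDerivAt (deriv φ) ((ω - Real.log (‖φ x‖ ^ 2)) • φ x) x := by
    intro x hx
    have h : ContDiffOn ℝ 1 (deriv φ) {0}ᶜ :=
      hC2.deriv_of_isOpen isOpen_compl_singleton (by norm_num)
    refine ((h.differentiableOn (by norm_num)).differentiableAt
      (isOpen_compl_singleton.mem_nhds hx)).hasDerivAt.congr_deriv ?_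
    rw [Complex.real_smul, Complex.ofReal_sub]
    linear_combination -heq x hx
  have hright := fun {x₀ : ℝ} => exists_eq_gausson_of_logNLS (x₀ := x₀)
    (fun x hx => hd x (ne_of_gt hx)) (fun x hx => hd2 x (ne_of_gt hx))
    (hdecay.mono_left atTop_le_cocompact) (hdecay'.mono_left atTop_le_cocompact)
  have hleft := fun {x₀ : ℝ} => exists_eq_gausson_of_logNLS (x₀ := x₀)
    (f := fun x => φ (-x)) (g := fun x => -deriv φ (-x)) (ω := ω)
    (fun x hx => by
      simpa [Function.comp_def] using (hd (-x) (neg_ne_zero.2 (ne_of_gt hx))).scomp x (hasDerivAt_neg x))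
    (fun x hx => by
      refine ((hd2 (-x) (neg_ne_zero.2 (ne_of_gt hx))).scomp x
        (hasDerivAt_neg x)).neg.congr_deriv ?_
      rw [neg_one_smul, neg_neg])
    ((hdecay.mono_left atBot_le_cocompact).comp tendsto_neg_atTop_atBot)
    (by simpa using
      ((hdecay'.mono_left atBot_le_cocompact).comp tendsto_neg_atTop_atBot).neg)
  have hneg : Tendsto (fun x : ℝ => -x) (𝓝[>] 0) (𝓝[<] 0) := by
    simpa using tendsto_neg_nhdsGT (a := (0 : ℝ))
  have hcontr : Tendsto φ (𝓝[>] 0) (𝓝 (φ 0)) := hcont.continuousWithinAt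
  have hcontl : Tendsto (fun x => φ (-x)) (𝓝[>] 0) (𝓝 (φ 0)) :=
    Tendsto.comp (hcont.continuousWithinAt (s := Iio 0)) hneg
  have hlimr := fun {A : ℂ} {c : ℝ} => gausson_limits_at_zero (A := A) (c := c) hcontr hLp
  have hliml := fun {A : ℂ} {c : ℝ} =>
    gausson_limits_at_zero (A := A) (c := c) hcontl (hLm.comp hneg).neg
  have hφ0 : φ 0 ≠ 0 := by
    obtain ⟨x, hx⟩ := hne
    rcases lt_trichotomy x 0 with h | h | h
    · obtain ⟨A, c, hA, hAc⟩ := hleft (neg_pos.2 h) (by simpa using hx)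
      rw [(hliml hAc).1]
      refine mul_ne_zero (norm_pos_iff.1 (hA ▸ Real.exp_pos _)) ?_
      exact_mod_cast (Real.exp_pos _).ne'
    · exact h ▸ hx
    · obtain ⟨A, c, hA, hAc⟩ := hright h hx
      rw [(hlimr hAc).1]
      refine mul_ne_zero (norm_pos_iff.1 (hA ▸ Real.exp_pos _)) ?_
      exact_mod_cast (Real.exp_pos _).ne'
  obtain ⟨x₁, hx₁, hx₁pos⟩ :=
    ((hcontr.eventually_ne hφ0).and self_mem_nhdsWithin).exists
  obtain ⟨x₂, hx₂, hx₂pos⟩ :=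
    ((hcontl.eventually_ne hφ0).and self_mem_nhdsWithin).exists
  obtain ⟨A, c, hA, hAc⟩ := hright hx₁pos hx₁
  obtain ⟨B, d, hB, hBd⟩ := hleft hx₂pos hx₂
  obtain ⟨hA0, hLpc⟩ := hlimr hAc
  obtain ⟨hB0, hLmd⟩ := hliml hBd
  have hsum : c + d = -γ := by
    have h : ((c + d : ℝ) : ℂ) = ((-γ : ℝ) : ℂ) := by
      apply mul_right_cancel₀ hφ0
      push_cast
      linear_combination hjump - hLpc - hLmd
    exact_mod_cast h
  have hsq : c ^ 2 = d ^ 2 := by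
    have h := congrArg norm (hA0.symm.trans hB0)
    rw [norm_mul, norm_mul, hA, hB, Complex.norm_real, Complex.norm_real, Real.norm_eq_abs,
      Real.norm_eq_abs, Real.abs_exp, Real.abs_exp] at h
    have h2 := Real.exp_injective (mul_left_cancel₀ (Real.exp_pos _).ne' h)
    linarith
  have hcd : c = d := by
    rcases sq_eq_sq_iff_eq_or_eq_neg.1 hsq with h | h
    · exact h
    · exact absurd (by linarith) hγ
  have hc : c = -(γ / 2) := by linarith
  subst hcd
  have hAB : A = B := by
    refine mul_right_cancel₀ ?_ (hA0.symm.trans hB0)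
    exact_mod_cast (Real.exp_pos _).ne'
  refine ⟨A.arg, fun x => ?_⟩
  have hAarg : Complex.exp (A.arg * Complex.I) * (Real.exp ((ω + 1) / 2) : ℂ) = A := by
    rw [← hA, mul_comm, Complex.norm_mul_exp_arg_mul_I]
  rw [hAarg]
  rcases lt_trichotomy x 0 with h | h | h
  · have h' := (hBd (-x) (neg_pos.2 h)).1
    rw [neg_neg] at h'
    rw [h', hAB, abs_of_neg h, hc, sub_neg_eq_add]
  · rw [h, hA0, hc, abs_zero, zero_add, neg_sq]
  · rw [(hAc x h).1, abs_of_pos h, hc, sub_neg_eq_add]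
end

section
/- Let ω ∈ ℝ. Suppose φ : (0,∞) → ℂ is not identically zero, is twice continuously differentiable, φ, φ', φ'' are square-integrable on (0,∞), φ(x) → 0 and φ'(x) → 0 as x → ∞, and -φ''(x) + ωφ(x) = φ(x)·log|φ(x)|² for every x > 0 (with the convention φ(x)·log|φ(x)|² = 0 when φ(x) = 0). Then there exist θ ∈ ℝ and x₊ ∈ ℝ such that φ(x) = e^{iθ} · e^{(ω+1)/2} · e^{-(x - x₊)²/2} for all x > 0. -/
open MeasureTheory Filter Set Topology

/-- The map `z ↦ ‖z‖² log ‖z‖²` has zero derivative along any differentiable curve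
at a zero of that curve. -/
lemma hasDerivAt_normSq_mul_log_of_eq_zero {φ : ℝ → ℂ} {φ' : ℂ} {x : ℝ}
    (h : HasDerivAt φ φ' x) (h0 : φ x = 0) :
    HasDerivAt (fun y => ‖φ y‖ ^ 2 * Real.log (‖φ y‖ ^ 2)) 0 x := by
  have hO : φ =O[𝓝 x] fun y => y - x := by
    simpa [h0] using h.differentiableAt.isBigO_sub
  have ht : Tendsto (fun y => 2 * (‖φ y‖ * Real.log ‖φ y‖)) (𝓝 x) (𝓝 0) := by
    have hc : ContinuousAt (fun y => 2 * (‖φ y‖ * Real.log ‖φ y‖)) x :=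
      continuousAt_const.mul
        (Real.continuous_mul_log.continuousAt.comp (f := fun y => ‖φ y‖) h.continuousAt.norm)
    simpa [ContinuousAt, h0] using hc
  rw [hasDerivAt_iff_isLittleO]
  have := hO.norm_left.mul_isLittleO ((Asymptotics.isLittleO_one_iff ℝ).2 ht)
  refine (this.congr_left fun y => ?_).congr_right fun y => by simp
  simp only [h0, Real.log_pow]
  simp
  ring

/-- Along a differentiable curve, `‖φ‖² log ‖φ‖² - ‖φ‖²` has derivative
`(‖φ‖²)' log ‖φ‖²`, also at the zeros of `φ`. -/
lemma hasDerivAt_normSq_mul_log_sub {φ : ℝ → ℂ} {φ' : ℂ} {x : ℝ} (h : HasDerivAt φ φ' x) :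
    HasDerivAt (fun y => ‖φ y‖ ^ 2 * Real.log (‖φ y‖ ^ 2) - ‖φ y‖ ^ 2)
      (2 * inner ℝ (φ x) φ' * Real.log (‖φ x‖ ^ 2)) x := by
  have hu : HasDerivAt (fun y => ‖φ y‖ ^ 2) (2 * inner ℝ (φ x) φ') x := h.norm_sq
  by_cases h0 : φ x = 0
  · refine HasDerivAt.congr_deriv ((hasDerivAt_normSq_mul_log_of_eq_zero h h0).sub hu) ?_
    simp [h0]
  · have hpos : ‖φ x‖ ^ 2 ≠ 0 := by positivity
    refine HasDerivAt.congr_deriv ((hu.mul (hu.log hpos)).sub hu) ?_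
    field_simp
    ring

/-- A function on `(0, ∞)` with zero derivative that vanishes at infinity is zero. -/
lemma eq_zero_of_hasDerivAt_zero_of_tendsto_s4 {f : ℝ → ℝ}
    (hf : ∀ x > 0, HasDerivAt f 0 x) (hlim : Tendsto f atTop (𝓝 0)) :
    ∀ x > 0, f x = 0 := by
  intro x hx
  have hconst : ∀ y > 0, f y = f x := fun y hy =>
    (isOpen_Ioi (a := (0 : ℝ))).is_const_of_deriv_eq_zero isPreconnected_Ioi
      (fun z hz => (hf z hz).differentiableAt.differentiableWithinAt)
      (fun z hz => (hf z hz).deriv) hy hx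
  refine tendsto_nhds_unique (tendsto_const_nhds.congr' ?_) hlim
  filter_upwards [eventually_gt_atTop 0] with y hy using (hconst y hy).symm

/-- Regularization bound for the logarithmic first-order inequality. -/
lemma sq_mul_sub_log_le {a b u v : ℝ} (hu : 0 < u) (huv : u ≤ v) (hab : a ≤ b)
    (hv : Real.log v ≤ b) :
    u ^ 2 * (a - Real.log u) ≤ v ^ 2 * (b + 1 - Real.log v) := by
  have hv0 : 0 < v := hu.trans_le huv
  have h1 : Real.log v - Real.log u ≤ v / u - 1 := by
    rw [← Real.log_div hv0.ne' hu.ne']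
    exact Real.log_le_sub_one_of_pos (by positivity)
  have h2 : u ^ 2 * (Real.log v - Real.log u) ≤ u * (v - u) := by
    calc _ ≤ u ^ 2 * (v / u - 1) := by gcongr
      _ = u * (v - u) := by field_simp
  have h3 : u * (v - u) ≤ v ^ 2 := by nlinarith
  have h4 : u ^ 2 * (a - Real.log v) ≤ u ^ 2 * (b - Real.log v) := by gcongr
  have h5 : u ^ 2 * (b - Real.log v) ≤ v ^ 2 * (b - Real.log v) :=
    mul_le_mul_of_nonneg_right (by gcongr) (by linarith)
  linarith

/-- Unique continuation: a curve with `‖φ'‖² = ‖φ‖² (a - log ‖φ‖²)` which is nonzero at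
one point of `(0, ∞)` has no zero there. -/
lemma ne_zero_of_norm_deriv_sq_eq {φ φ' : ℝ → ℂ} {a : ℝ}
    (h : ∀ x > 0, HasDerivAt φ (φ' x) x)
    (hE : ∀ x > 0, ‖φ' x‖ ^ 2 = ‖φ x‖ ^ 2 * (a - Real.log (‖φ x‖ ^ 2)))
    {x₁ : ℝ} (hx₁ : 0 < x₁) (hne : φ x₁ ≠ 0) : ∀ x > 0, φ x ≠ 0 := by
  intro x₀ hx₀ h0
  set b := Real.log (Real.exp a + 1) with hb
  have hab : a ≤ b := by
    rw [hb, Real.le_log_iff_exp_le (by positivity)]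
    linarith
  have hbound : ∀ x > 0, ‖φ x‖ ^ 2 ≤ Real.exp a := by
    intro x hx
    by_cases hz : φ x = 0
    · simp [hz, Real.exp_nonneg]
    · have hpos : 0 < ‖φ x‖ ^ 2 := by positivity
      rw [← Real.log_le_iff_le_exp hpos]
      have := nonneg_of_mul_nonneg_right ((hE x hx) ▸ sq_nonneg ‖φ' x‖) hpos
      linarith
  have hlip : ∀ ε > 0, ε ≤ 1 → √(b + 1 - Real.log ε) ≤
      √(b + 1 - Real.log (‖φ x₁‖ ^ 2)) + |x₀ - x₁| := by
    intro ε hε hε1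
    have hlogv : ∀ x > 0, Real.log (‖φ x‖ ^ 2 + ε) ≤ b := fun x hx =>
      Real.log_le_log (by positivity) (by linarith [hbound x hx])
    have hg : ∀ x > 0, HasDerivAt (fun y => √(b + 1 - Real.log (‖φ y‖ ^ 2 + ε)))
        (-(2 * inner ℝ (φ x) (φ' x) / (‖φ x‖ ^ 2 + ε)) /
          (2 * √(b + 1 - Real.log (‖φ x‖ ^ 2 + ε)))) x := fun x hx =>
      ((((h x hx).norm_sq.add_const ε).log (by positivity)).const_sub (b + 1)).sqrt
        (by linarith [hlogv x hx])
    have hg' : ∀ x > 0, ‖-(2 * inner ℝ (φ x) (φ' x) / (‖φ x‖ ^ 2 + ε)) /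
          (2 * √(b + 1 - Real.log (‖φ x‖ ^ 2 + ε)))‖ ≤ 1 := by
      intro x hx
      have hG : 0 < b + 1 - Real.log (‖φ x‖ ^ 2 + ε) := by linarith [hlogv x hx]
      have hs : 0 < √(b + 1 - Real.log (‖φ x‖ ^ 2 + ε)) := Real.sqrt_pos.2 hG
      have hv : 0 < ‖φ x‖ ^ 2 + ε := by positivity
      have hkey : |inner ℝ (φ x) (φ' x)| ≤
          (‖φ x‖ ^ 2 + ε) * √(b + 1 - Real.log (‖φ x‖ ^ 2 + ε)) := by
        refine (abs_real_inner_le_norm _ _).trans ?_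
        refine le_of_sq_le_sq ?_ (by positivity)
        rw [mul_pow, mul_pow, Real.sq_sqrt hG.le, hE x hx]
        by_cases hz : φ x = 0
        · simp only [hz, norm_zero]
          rw [hz, norm_zero] at hG
          have := mul_nonneg (sq_nonneg (0 ^ 2 + ε)) hG.le
          simpa using this
        · have := sq_mul_sub_log_le (u := ‖φ x‖ ^ 2) (v := ‖φ x‖ ^ 2 + ε)
            (by positivity) (by linarith) hab (hlogv x hx)
          linarith
      rw [Real.norm_eq_abs, abs_div, abs_neg, abs_div, abs_mul, abs_two, abs_of_pos hv,
        abs_of_pos (by positivity : 0 < 2 * √(b + 1 - Real.log (‖φ x‖ ^ 2 + ε))),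
        div_le_one (by positivity), div_le_iff₀ hv]
      linarith
    have hmv := (convex_Ioi (0 : ℝ)).norm_image_sub_le_of_norm_hasDerivWithin_le
      (fun x hx => (hg x hx).hasDerivWithinAt) hg' hx₁ hx₀
    rw [Real.norm_eq_abs, Real.norm_eq_abs, one_mul] at hmv
    have h1 := (le_abs_self _).trans hmv
    have h2 : √(b + 1 - Real.log (‖φ x₁‖ ^ 2 + ε)) ≤ √(b + 1 - Real.log (‖φ x₁‖ ^ 2)) := by
      gcongr
      linarith
    simp only [h0, norm_zero, ne_eq, OfNat.ofNat_ne_zero, not_false_eq_true, zero_pow,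
      zero_add] at h1
    linarith
  set M := √(b + 1 - Real.log (‖φ x₁‖ ^ 2)) + |x₀ - x₁|
  have hM : 0 ≤ M := by positivity
  have ht : 0 ≤ M ^ 2 + |b| := by positivity
  have := hlip (Real.exp (-(M ^ 2 + |b|))) (Real.exp_pos _) (Real.exp_le_one_iff.2 (by linarith))
  rw [Real.log_exp, Real.sqrt_le_left hM] at this
  linarith [neg_abs_le b]

/-- Half-line classification: any nontrivial `H²((0,∞))` solution of the stationary
logarithmic Schrödinger equation `-φ'' + ωφ = φ log|φ|²` on `(0,∞)`, decaying together
with its derivative at `+∞`, is a constant phase times a shifted Gaussian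
`e^{(ω+1)/2} e^{-(x-x₊)²/2}`. -/
theorem stmt4 (ω : ℝ) (φ : ℝ → ℂ)
    (hne : ∃ x ∈ Set.Ioi (0 : ℝ), φ x ≠ 0)
    (hC2 : ContDiffOn ℝ 2 φ (Set.Ioi (0 : ℝ)))
    (hφL2 : IntegrableOn (fun x => ‖φ x‖ ^ 2) (Set.Ioi (0 : ℝ)))
    (hφ'L2 : IntegrableOn (fun x => ‖deriv φ x‖ ^ 2) (Set.Ioi (0 : ℝ)))
    (hφ''L2 : IntegrableOn (fun x => ‖deriv (deriv φ) x‖ ^ 2) (Set.Ioi (0 : ℝ)))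
    (hdecay : Tendsto φ atTop (𝓝 0))
    (hdecay' : Tendsto (deriv φ) atTop (𝓝 0))
    (heq : ∀ x > (0 : ℝ), -(deriv (deriv φ) x) + (ω : ℂ) * φ x
      = φ x * (Real.log (‖φ x‖ ^ 2) : ℂ)) :
    ∃ θ xplus : ℝ, ∀ x > (0 : ℝ), φ x = Complex.exp (θ * Complex.I) *
      (Real.exp ((ω + 1) / 2) : ℂ) * (Real.exp (-(x - xplus) ^ 2 / 2) : ℂ) := by
  have hopen : IsOpen (Set.Ioi (0 : ℝ)) := isOpen_Ioi
  have h1 : ∀ x > 0, HasDerivAt φ (deriv φ x) x := fun x hx =>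
    ((hC2.differentiableOn (by norm_num)).differentiableAt (hopen.mem_nhds hx)).hasDerivAt
  have h2 : ∀ x > 0, HasDerivAt (deriv φ) (((ω - Real.log (‖φ x‖ ^ 2) : ℝ) : ℂ) * φ x) x := by
    intro x hx
    have hd : ContDiffOn ℝ 1 (deriv φ) (Set.Ioi 0) :=
      hC2.deriv_of_isOpen hopen (by norm_num)
    refine HasDerivAt.congr_deriv (((hd.differentiableOn (by norm_num)).differentiableAt
      (hopen.mem_nhds hx)).hasDerivAt) ?_
    push_cast
    linear_combination -(heq x hx)
  have hn : Tendsto (fun x => ‖φ x‖ ^ 2) atTop (𝓝 0) := by simpa using hdecay.norm.pow 2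
  have hn' : Tendsto (fun x => ‖deriv φ x‖ ^ 2) atTop (𝓝 0) := by simpa using hdecay'.norm.pow 2
  have hE : ∀ x > 0, ‖deriv φ x‖ ^ 2 =
      ‖φ x‖ ^ 2 * (ω + 1 - Real.log (‖φ x‖ ^ 2)) := by
    have := eq_zero_of_hasDerivAt_zero_of_tendsto_s4
      (f := fun x => ‖deriv φ x‖ ^ 2 - ω * ‖φ x‖ ^ 2 +
        (‖φ x‖ ^ 2 * Real.log (‖φ x‖ ^ 2) - ‖φ x‖ ^ 2)) ?_ ?_
    · intro x hx
      linarith [this x hx]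
    · intro x hx
      refine HasDerivAt.congr_deriv (((h2 x hx).norm_sq.sub ((h1 x hx).norm_sq.const_mul ω)).add
        (hasDerivAt_normSq_mul_log_sub (h1 x hx))) ?_
      rw [← Complex.real_smul, real_inner_smul_right, real_inner_comm]
      ring
    · have hl : Tendsto (fun x => ‖φ x‖ ^ 2 * Real.log (‖φ x‖ ^ 2)) atTop (𝓝 0) := by
        have := (Real.continuous_mul_log.tendsto 0).comp hn
        rwa [zero_mul] at this
      simpa using (hn'.sub (hn.const_mul ω)).add (hl.sub hn)
  have hJ : ∀ x > 0, (starRingEnd ℂ (φ x) * deriv φ x).im = 0 := by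
    refine eq_zero_of_hasDerivAt_zero_of_tendsto_s4 (fun x hx => ?_) ?_
    · refine HasDerivAt.congr_deriv (Complex.imCLM.hasFDerivAt.comp_hasDerivAt x
        ((h1 x hx).star.mul (h2 x hx))) ?_
      simp [Complex.mul_im, Complex.mul_re]
      ring
    · have := (Complex.continuous_im.tendsto _).comp (hdecay.star.mul hdecay')
      simpa [Function.comp_def] using this
  obtain ⟨x₁, hx₁, hne₁⟩ := hne
  have hnz := ne_zero_of_norm_deriv_sq_eq h1 hE hx₁ hne₁
  have hsq : ∀ x > 0, (deriv φ x / φ x) ^ 2 = ((ω + 1 - Real.log (‖φ x‖ ^ 2) : ℝ) : ℂ) ∧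
      (deriv φ x / φ x).im = 0 := by
    intro x hx
    have hu : (‖φ x‖ ^ 2 : ℝ) ≠ 0 := by have := hnz x hx; positivity
    have hk : deriv φ x / φ x =
        (((starRingEnd ℂ (φ x) * deriv φ x).re / ‖φ x‖ ^ 2 : ℝ) : ℂ) := by
      have hre : (((starRingEnd ℂ (φ x) * deriv φ x).re : ℝ) : ℂ) =
          starRingEnd ℂ (φ x) * deriv φ x := by
        apply Complex.ext <;> simp only [Complex.ofReal_re, Complex.ofReal_im, hJ x hx]
      rw [Complex.ofReal_div, hre, Complex.ofReal_pow, ← Complex.conj_mul', mul_div_mul_left]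
      simpa using hnz x hx
    refine ⟨?_, by rw [hk, Complex.ofReal_im]⟩
    have habs : ‖deriv φ x / φ x‖ ^ 2 = ω + 1 - Real.log (‖φ x‖ ^ 2) := by
      rw [norm_div, div_pow, hE x hx, mul_div_cancel_left₀ _ hu]
    rw [← habs, hk, Complex.norm_real, Real.norm_eq_abs, sq_abs, Complex.ofReal_pow]
  have hk' : ∀ x > 0, HasDerivAt (fun y => deriv φ y / φ y + y) 0 x := by
    intro x hx
    refine HasDerivAt.congr_deriv (((h2 x hx).div (h1 x hx) (hnz x hx)).add
      (hasDerivAt_id x).ofReal_comp) ?_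
    have hs := (hsq x hx).1
    have := hnz x hx
    push_cast at hs ⊢
    field_simp at hs ⊢
    linear_combination -hs
  set c : ℝ := (deriv φ x₁ / φ x₁ + x₁).re with hc
  have hkc : ∀ x > 0, deriv φ x / φ x = ((-(x - c) : ℝ) : ℂ) := by
    intro x hx
    have hconst : deriv φ x / φ x + x = deriv φ x₁ / φ x₁ + x₁ :=
      hopen.is_const_of_deriv_eq_zero isPreconnected_Ioi
        (fun z hz => (hk' z hz).differentiableAt.differentiableWithinAt)
        (fun z hz => (hk' z hz).deriv) hx hx₁
    have hcc : deriv φ x₁ / φ x₁ + x₁ = (c : ℂ) := by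
      apply Complex.ext
      · simp [hc]
      · rw [Complex.add_im, (hsq x₁ hx₁).2]; simp
    push_cast
    linear_combination hconst + hcc
  have hnorm : ∀ x > 0, ‖φ x‖ = Real.exp ((ω + 1) / 2) * Real.exp (-(x - c) ^ 2 / 2) := by
    intro x hx
    have hs := (hsq x hx).1
    rw [hkc x hx] at hs
    have hs' : (-(x - c)) ^ 2 = ω + 1 - Real.log (‖φ x‖ ^ 2) := by exact_mod_cast hs
    rw [Real.log_pow] at hs'
    rw [← Real.exp_add, ← Real.exp_log (norm_pos_iff.2 (hnz x hx))]
    congr 1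
    push_cast at hs'
    linarith
  have hdir : ∀ x > 0, HasDerivAt (fun y => φ y * (Real.exp ((y - c) ^ 2 / 2) : ℂ)) 0 x := by
    intro x hx
    have he : HasDerivAt (fun y : ℝ => Real.exp ((y - c) ^ 2 / 2))
        (Real.exp ((x - c) ^ 2 / 2) * (x - c)) x := by
      refine HasDerivAt.congr_deriv (((((hasDerivAt_id x).sub_const c).pow 2).div_const 2).exp) ?_
      simp
    refine HasDerivAt.congr_deriv ((h1 x hx).mul he.ofReal_comp) ?_
    have := (div_eq_iff (hnz x hx)).1 (hkc x hx)
    rw [this]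
    push_cast
    ring
  refine ⟨(φ x₁).arg, c, fun x hx => ?_⟩
  have hconst : φ x * (Real.exp ((x - c) ^ 2 / 2) : ℂ) =
      φ x₁ * (Real.exp ((x₁ - c) ^ 2 / 2) : ℂ) :=
    hopen.is_const_of_deriv_eq_zero isPreconnected_Ioi
      (fun z hz => (hdir z hz).differentiableAt.differentiableWithinAt)
      (fun z hz => (hdir z hz).deriv) hx hx₁
  have hcancel : ∀ y : ℝ, (Real.exp (-(y - c) ^ 2 / 2) : ℂ) * Real.exp ((y - c) ^ 2 / 2) = 1 := by
    intro y
    rw [← Complex.ofReal_mul, ← Real.exp_add, neg_div, neg_add_cancel, Real.exp_zero,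
      Complex.ofReal_one]
  have hpolar := Complex.norm_mul_exp_arg_mul_I (φ x₁)
  rw [hnorm x₁ hx₁, Complex.ofReal_mul] at hpolar
  rw [← hpolar] at hconst
  linear_combination (Real.exp (-(x - c) ^ 2 / 2) : ℂ) * hconst - φ x * hcancel x +
    Complex.exp ((φ x₁).arg * Complex.I) * Real.exp ((ω + 1) / 2) *
      Real.exp (-(x - c) ^ 2 / 2) * hcancel x₁
end

section
/- Let ω ∈ ℝ. Suppose ρ : (0,∞) → ℝ is twice continuously differentiable with ρ(x) > 0 for all x > 0, ρ, ρ', ρ'' are square-integrable on (0,∞), ρ(x) → 0 and ρ'(x) → 0 as x → ∞, and -ρ''(x) + ωρ(x) - ρ(x)·log(ρ(x)²) = 0 for every x > 0. Then for every x > 0 one has (ρ'(x))² = (1+ω)·ρ(x)² - ρ(x)²·log(ρ(x)²). -/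
open MeasureTheory Filter Set Topology

/-- The energy `(ρ')² - (1+ω)ρ² + ρ² log(ρ²)` is stationary along positive solutions of
`-ρ'' + ωρ - ρ log(ρ²) = 0`. -/
theorem hasDerivAt_energy_zero {ω a b x : ℝ} {ρ σ : ℝ → ℝ} (hρ : HasDerivAt ρ a x)
    (hσ : HasDerivAt σ b x) (hσx : σ x = a) (hx : ρ x ≠ 0)
    (heq : -b + ω * ρ x - ρ x * Real.log (ρ x ^ 2) = 0) :
    HasDerivAt (fun y => σ y ^ 2 - (1 + ω) * ρ y ^ 2 + ρ y ^ 2 * Real.log (ρ y ^ 2)) 0 x := by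
  have hρ2 : HasDerivAt (fun y => ρ y ^ 2) (2 * ρ x * a) x := by
    simpa using hρ.fun_pow 2
  have hσ2 : HasDerivAt (fun y => σ y ^ 2) (2 * σ x * b) x := by
    simpa using hσ.fun_pow 2
  have hlog := hρ2.log (pow_ne_zero 2 hx)
  refine ((hσ2.sub (hρ2.const_mul (1 + ω))).add (hρ2.mul hlog)).congr_deriv ?_
  have hb : b = ω * ρ x - ρ x * Real.log (ρ x ^ 2) := by linarith
  rw [hσx, hb]
  field_simp
  ring

/-- The energy tends to `0` when its two arguments do. -/
theorem tendsto_energy_zero {ω : ℝ} {α : Type*} {l : Filter α} {ρ σ : α → ℝ}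
    (hρ : Tendsto ρ l (𝓝 0)) (hσ : Tendsto σ l (𝓝 0)) :
    Tendsto (fun y => σ y ^ 2 - (1 + ω) * ρ y ^ 2 + ρ y ^ 2 * Real.log (ρ y ^ 2)) l (𝓝 0) := by
  have hρ2 : Tendsto (fun y => ρ y ^ 2) l (𝓝 0) := by simpa using hρ.pow 2
  have hσ2 : Tendsto (fun y => σ y ^ 2) l (𝓝 0) := by simpa using hσ.pow 2
  have hlog : Tendsto (fun y => ρ y ^ 2 * Real.log (ρ y ^ 2)) l (𝓝 0) := by
    simpa only [zero_mul, Function.comp_def] using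
      (Real.continuous_mul_log.tendsto 0).comp hρ2
  simpa using (hσ2.sub (hρ2.const_mul (1 + ω))).add hlog

/-- First-integral identity on the half-line: a positive `H²((0,∞))` solution of
`-ρ'' + ωρ - ρ log(ρ²) = 0` on `(0,∞)`, decaying together with its derivative at `+∞`,
satisfies `(ρ')² = (1+ω)ρ² - ρ² log(ρ²)` on `(0,∞)`. -/
theorem stmt5 (ω : ℝ) (ρ : ℝ → ℝ)
    (hC2 : ContDiffOn ℝ 2 ρ (Set.Ioi (0 : ℝ)))
    (hpos : ∀ x > (0 : ℝ), 0 < ρ x)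
    (hρL2 : IntegrableOn (fun x => ρ x ^ 2) (Set.Ioi (0 : ℝ)))
    (hρ'L2 : IntegrableOn (fun x => deriv ρ x ^ 2) (Set.Ioi (0 : ℝ)))
    (hρ''L2 : IntegrableOn (fun x => deriv (deriv ρ) x ^ 2) (Set.Ioi (0 : ℝ)))
    (hdecay : Tendsto ρ atTop (𝓝 0))
    (hdecay' : Tendsto (deriv ρ) atTop (𝓝 0))
    (heq : ∀ x > (0 : ℝ), -(deriv (deriv ρ) x) + ω * ρ x - ρ x * Real.log (ρ x ^ 2) = 0) :
    ∀ x > (0 : ℝ), (deriv ρ x) ^ 2 = (1 + ω) * ρ x ^ 2 - ρ x ^ 2 * Real.log (ρ x ^ 2) := by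
  have hρ : ∀ x > (0 : ℝ), HasDerivAt ρ (deriv ρ x) x := fun x hx =>
    ((hC2.differentiableOn two_ne_zero).differentiableAt (Ioi_mem_nhds hx)).hasDerivAt
  have hρ' : ∀ x > (0 : ℝ), HasDerivAt (deriv ρ) (deriv (deriv ρ) x) x := fun x hx =>
    (((hC2.deriv_of_isOpen (m := 1) isOpen_Ioi (by norm_num)).differentiableOn
      one_ne_zero).differentiableAt (Ioi_mem_nhds hx)).hasDerivAt
  have hE : ∀ x > (0 : ℝ), HasDerivAt
      (fun y => deriv ρ y ^ 2 - (1 + ω) * ρ y ^ 2 + ρ y ^ 2 * Real.log (ρ y ^ 2)) 0 x :=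
    fun x hx => hasDerivAt_energy_zero (hρ x hx) (hρ' x hx) rfl (hpos x hx).ne' (heq x hx)
  obtain ⟨c, hc⟩ := isOpen_Ioi.exists_is_const_of_deriv_eq_zero isPreconnected_Ioi
    (fun x hx => (hE x hx).differentiableAt.differentiableWithinAt) (fun x hx => (hE x hx).deriv)
  have hc0 : c = 0 := by
    refine tendsto_nhds_unique (tendsto_const_nhds.congr' ?_)
      (tendsto_energy_zero (ω := ω) hdecay hdecay')
    filter_upwards [Ioi_mem_atTop (0 : ℝ)] with x hx using (hc x hx).symm
  intro x hx
  have hx0 := hc x hx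
  simp only [hc0] at hx0
  linarith
end

section
/- Let γ ∈ ℝ with γ ≠ 0. Suppose u : ℝ → ℂ is continuous on ℝ, twice continuously differentiable on ℝ\{0}, u and u' are square-integrable on ℝ and u'' is square-integrable on ℝ\{0}, the one-sided limits u'(0⁺), u'(0⁻) exist and satisfy u'(0⁺) - u'(0⁻) = -γ·u(0), and -u''(x) + ((|x| + γ/2)² - 1)·u(x) = 0 for every x ≠ 0. Then there exists c ∈ ℂ such that u(x) = c · e^{-(|x|+γ/2)²/2} for all x ∈ ℝ. -/
open MeasureTheory Filter Set Topology

lemma exists_const_on_Ioi_of_hasDerivAt_zero {f : ℝ → ℂ} {b : ℝ}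
    (hf : ∀ x > b, HasDerivAt f 0 x) : ∃ c, ∀ x > b, f x = c :=
  isOpen_Ioi.exists_is_const_of_deriv_eq_zero (convex_Ioi b).isPreconnected
    (fun x hx => (hf x hx).differentiableAt.differentiableWithinAt) (fun x hx => (hf x hx).deriv)

lemma abs_mul_exp_neg_sq_div_two_le_one (t : ℝ) : |t| * Real.exp (-t ^ 2 / 2) ≤ 1 := by
  have h : |t| ≤ Real.exp (t ^ 2 / 2) := by
    have := Real.add_one_le_exp (t ^ 2 / 2)
    nlinarith [sq_nonneg (|t| - 1), sq_abs t]
  calc |t| * Real.exp (-t ^ 2 / 2) ≤ Real.exp (t ^ 2 / 2) * Real.exp (-t ^ 2 / 2) := by gcongr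
    _ = 1 := by rw [← Real.exp_add]; ring_nf; simp

lemma hasDerivAt_ofReal_exp_mul_sq (a k x : ℝ) :
    HasDerivAt (fun y : ℝ => (Real.exp (k * (y + a) ^ 2 / 2) : ℂ))
      ((k * (x + a) : ℝ) * (Real.exp (k * (x + a) ^ 2 / 2) : ℂ)) x := by
  have h : HasDerivAt (fun y : ℝ => Real.exp (k * (y + a) ^ 2 / 2))
      (k * (x + a) * Real.exp (k * (x + a) ^ 2 / 2)) x := by
    refine (((((hasDerivAt_id' x).add_const a).fun_pow 2).const_mul k).div_const 2).exp.congr_deriv ?_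
    ring
  exact_mod_cast h.ofReal_comp

/-- Square-integrable solutions of the shifted harmonic oscillator equation
`f'' = ((x + a)² - 1) f` on the half-line are multiples of a Gaussian. -/
lemma eq_const_mul_gaussian_of_oscillator_Ioi {a : ℝ} {f g : ℝ → ℂ} (hfc : Continuous f)
    (hf : ∀ x > 0, HasDerivAt f (g x) x)
    (hg : ∀ x > 0, HasDerivAt g ((((x + a) ^ 2 - 1 : ℝ) : ℂ) * f x) x)
    (hf2 : IntegrableOn (fun x => ‖f x‖ ^ 2) (Ioi 0))
    (hg2 : IntegrableOn (fun x => ‖g x‖ ^ 2) (Ioi 0)) :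
    ∀ x ≥ 0, f x = f 0 * (Real.exp (a ^ 2 / 2) : ℂ) * (Real.exp (-(x + a) ^ 2 / 2) : ℂ) := by
  have hshift (x : ℝ) : HasDerivAt (fun y : ℝ => ((y + a : ℝ) : ℂ)) 1 x := by
    simpa using ((hasDerivAt_id x).add_const a).ofReal_comp
  obtain ⟨C, hC⟩ : ∃ C : ℂ, ∀ x > 0,
      (g x + ((x + a : ℝ) : ℂ) * f x) * (Real.exp (-1 * (x + a) ^ 2 / 2) : ℂ) = C := by
    refine exists_const_on_Ioi_of_hasDerivAt_zero fun x hx => ?_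
    refine (((hg x hx).fun_add ((hshift x).fun_mul (hf x hx))).fun_mul
      (hasDerivAt_ofReal_exp_mul_sq a (-1) x)).congr_deriv ?_
    push_cast
    ring
  have hbound : ∀ x > 0, ‖C‖ ^ 2 ≤ 2 * (‖g x‖ ^ 2 + ‖f x‖ ^ 2) := by
    intro x hx
    have h1 : Real.exp (-1 * (x + a) ^ 2 / 2) ≤ 1 := Real.exp_le_one_iff.2 (by
      nlinarith [sq_nonneg (x + a)])
    have h2 : |x + a| * Real.exp (-1 * (x + a) ^ 2 / 2) ≤ 1 := by
      simpa using abs_mul_exp_neg_sq_div_two_le_one (x + a)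
    have h3 : ‖C‖ ≤ ‖g x‖ + ‖f x‖ := by
      rw [← hC x hx, norm_mul, Complex.norm_real, Real.norm_eq_abs, Real.abs_exp]
      calc _ ≤ (‖g x‖ + |x + a| * ‖f x‖) * Real.exp (-1 * (x + a) ^ 2 / 2) := by
            gcongr
            refine (norm_add_le _ _).trans_eq ?_
            rw [norm_mul, Complex.norm_real, Real.norm_eq_abs]
        _ = ‖g x‖ * Real.exp (-1 * (x + a) ^ 2 / 2)
            + (|x + a| * Real.exp (-1 * (x + a) ^ 2 / 2)) * ‖f x‖ := by ring
        _ ≤ ‖g x‖ * 1 + 1 * ‖f x‖ := by gcongr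
        _ = _ := by ring
    nlinarith [sq_nonneg (‖g x‖ - ‖f x‖), norm_nonneg C]
  have hC0 : C = 0 := by
    have hint : IntegrableOn (fun _ : ℝ => ‖C‖ ^ 2) (Ioi (0 : ℝ)) := by
      refine ((hg2.add hf2).const_mul 2).mono' aestronglyMeasurable_const ?_
      filter_upwards [ae_restrict_mem measurableSet_Ioi] with x hx
      simpa using hbound x hx
    rw [integrableOn_const_iff] at hint
    simpa using hint
  have hw : ∀ x > 0, g x + ((x + a : ℝ) : ℂ) * f x = 0 := fun x hx =>
    (mul_eq_zero.1 ((hC x hx).trans hC0)).resolve_right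
      (Complex.ofReal_ne_zero.2 (Real.exp_ne_zero _))
  obtain ⟨c, hc⟩ : ∃ c : ℂ, ∀ x > 0, f x * (Real.exp (1 * (x + a) ^ 2 / 2) : ℂ) = c := by
    refine exists_const_on_Ioi_of_hasDerivAt_zero fun x hx => ?_
    refine ((hf x hx).fun_mul (hasDerivAt_ofReal_exp_mul_sq a 1 x)).congr_deriv ?_
    rw [one_mul (x + a)]
    linear_combination (Real.exp (1 * (x + a) ^ 2 / 2) : ℂ) * hw x hx
  have hclosure : EqOn (fun x => f x * (Real.exp (1 * (x + a) ^ 2 / 2) : ℂ)) (fun _ => c)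
      (Ici 0) := by
    rw [← closure_Ioi]
    exact EqOn.closure (fun x hx => hc x hx) (by fun_prop) continuous_const
  intro x hx
  have h0 : f 0 * (Real.exp (a ^ 2 / 2) : ℂ) = c := by
    simpa using hclosure (mem_Ici.2 le_rfl)
  have hx' : f x * (Real.exp (1 * (x + a) ^ 2 / 2) : ℂ) = c := hclosure hx
  rw [h0, ← hx', mul_assoc, ← Complex.ofReal_mul, ← Real.exp_add]
  ring_nf
  simp

/-- The kernel of the linearized operator `L₂^γ = -d²/dx² + (|x|+γ/2)² - 1` with
δ-interaction jump condition `u'(0⁺) - u'(0⁻) = -γu(0)` is spanned by the peak-Gausson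
profile `x ↦ e^{-(|x|+γ/2)²/2}`. -/
theorem stmt6 (γ : ℝ) (hγ : γ ≠ 0) (u : ℝ → ℂ)
    (hcont : Continuous u)
    (hC2 : ContDiffOn ℝ 2 u {0}ᶜ)
    (huL2 : Integrable (fun x => ‖u x‖ ^ 2))
    (hu'L2 : Integrable (fun x => ‖deriv u x‖ ^ 2))
    (hu''L2 : IntegrableOn (fun x => ‖deriv (deriv u) x‖ ^ 2) ({0}ᶜ))
    (Lp Lm : ℂ)
    (hLp : Tendsto (deriv u) (𝓝[>] (0 : ℝ)) (𝓝 Lp))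
    (hLm : Tendsto (deriv u) (𝓝[<] (0 : ℝ)) (𝓝 Lm))
    (hjump : Lp - Lm = -(γ : ℂ) * u 0)
    (heq : ∀ x ≠ 0, -(deriv (deriv u) x)
      + (((|x| + γ / 2) ^ 2 - 1 : ℝ) : ℂ) * u x = 0) :
    ∃ c : ℂ, ∀ x : ℝ, u x = c * (Real.exp (-(|x| + γ / 2) ^ 2 / 2) : ℂ) := by
  have hu (x : ℝ) (hx : x ≠ 0) : ContDiffAt ℝ 2 u x :=
    hC2.contDiffAt (isOpen_compl_singleton.mem_nhds hx)
  have hd (x : ℝ) (hx : x ≠ 0) : HasDerivAt u (deriv u x) x :=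
    ((hu x hx).differentiableAt (by norm_num)).hasDerivAt
  have hdd (x : ℝ) (hx : x ≠ 0) :
      HasDerivAt (deriv u) ((((|x| + γ / 2) ^ 2 - 1 : ℝ) : ℂ) * u x) x := by
    have h : DifferentiableAt ℝ (deriv u) x :=
      ((hC2.deriv_of_isOpen (m := 1) isOpen_compl_singleton (by norm_num)).contDiffAt
        (isOpen_compl_singleton.mem_nhds hx)).differentiableAt (by norm_num)
    refine h.hasDerivAt.congr_deriv ?_
    linear_combination -heq x hx
  have hpos := eq_const_mul_gaussian_of_oscillator_Ioi (a := γ / 2) hcont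
    (fun x hx => hd x hx.ne')
    (fun x hx => by simpa only [abs_of_pos hx] using hdd x hx.ne')
    huL2.integrableOn hu'L2.integrableOn
  have hneg := eq_const_mul_gaussian_of_oscillator_Ioi (a := γ / 2)
    (f := fun x => u (-x)) (g := fun x => -deriv u (-x)) (by fun_prop)
    (fun x hx => ((hd (-x) (neg_ne_zero.2 hx.ne')).scomp x (hasDerivAt_neg x)).congr_deriv
      (by simp))
    (fun x hx => ((hdd (-x) (neg_ne_zero.2 hx.ne')).scomp x (hasDerivAt_neg x)).fun_neg.congr_deriv
      (by simp [abs_of_pos hx]))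
    huL2.comp_neg.integrableOn (by simpa using hu'L2.comp_neg.integrableOn)
  refine ⟨u 0 * (Real.exp ((γ / 2) ^ 2 / 2) : ℂ), fun x => ?_⟩
  rcases le_total 0 x with hx | hx
  · simpa only [abs_of_nonneg hx] using hpos x hx
  · simpa only [abs_of_nonpos hx, neg_neg, neg_zero] using hneg (-x) (neg_nonneg.2 hx)
end

section
/- Let γ ∈ ℝ, let V : ℝ → ℝ be continuous, and let λ₁ < λ₂ be real numbers. For i = 1,2 suppose φᵢ : ℝ → ℝ is continuous on ℝ, twice continuously differentiable on ℝ\{0}, the one-sided limits φᵢ'(0⁺), φᵢ'(0⁻) exist and satisfy φᵢ'(0⁺) - φᵢ'(0⁻) = -γ·φᵢ(0), and -φᵢ''(x) + V(x)·φᵢ(x) = λᵢ·φᵢ(x) for every x ≠ 0. Let a < 0 < b be real numbers such that φ₁(a) = φ₁(b) = 0 and φ₁(x) > 0 for all x ∈ (a,b). Then there exists c ∈ (a,b) with φ₂(c) = 0. -/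
open MeasureTheory Filter Set Topology

theorem HasDerivAt.nonneg_of_nonneg_right {f : ℝ → ℝ} {f' a b : ℝ} (hf : HasDerivAt f f' a)
    (hab : a < b) (ha : f a = 0) (hpos : ∀ x ∈ Ioo a b, 0 ≤ f x) : 0 ≤ f' := by
  have h := (hasDerivWithinAt_iff_tendsto_slope' (s := Ioi a) (by simp)).1 hf.hasDerivWithinAt
  refine ge_of_tendsto h ?_
  filter_upwards [Ioo_mem_nhdsGT hab] with x hx
  rw [slope_def_field, ha, sub_zero]
  exact div_nonneg (hpos x hx) (sub_nonneg.2 hx.1.le)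

theorem HasDerivAt.nonpos_of_nonneg_left {f : ℝ → ℝ} {f' a b : ℝ} (hf : HasDerivAt f f' b)
    (hab : a < b) (hb : f b = 0) (hpos : ∀ x ∈ Ioo a b, 0 ≤ f x) : f' ≤ 0 := by
  have h := (hasDerivWithinAt_iff_tendsto_slope' (s := Iio b) (by simp)).1 hf.hasDerivWithinAt
  refine le_of_tendsto h ?_
  filter_upwards [Ioo_mem_nhdsLT hab] with x hx
  rw [slope_def_field, hb, sub_zero]
  exact div_nonpos_of_nonneg_of_nonpos (hpos x hx) (sub_nonpos.2 hx.2.le)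

theorem ContDiffOn.hasDerivAt_deriv_of_isOpen {f : ℝ → ℝ} {s : Set ℝ} (hs : IsOpen s)
    (hf : ContDiffOn ℝ 2 f s) {x : ℝ} (hx : x ∈ s) :
    HasDerivAt f (deriv f x) x ∧ HasDerivAt (deriv f) (deriv (deriv f) x) x := by
  refine ⟨((hf.differentiableOn (by norm_num)).differentiableAt (hs.mem_nhds hx)).hasDerivAt, ?_⟩
  have h : ContDiffOn ℝ 1 (deriv f) s := hf.deriv_of_isOpen hs (by norm_num)
  exact ((h.differentiableOn (by norm_num)).differentiableAt (hs.mem_nhds hx)).hasDerivAt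

/-- A strictly increasing function on `[a, c)` which is nonnegative at `a` has a positive left
limit at `c`. -/
theorem StrictMonoOn.pos_of_tendsto_left {W : ℝ → ℝ} {a c l : ℝ} (hW : StrictMonoOn W (Ico a c))
    (hac : a < c) (ha : 0 ≤ W a) (hl : Tendsto W (𝓝[<] c) (𝓝 l)) : 0 < l := by
  obtain ⟨m, ham, hmc⟩ := exists_between hac
  have hm : W a < W m := hW ⟨le_rfl, hac⟩ ⟨ham.le, hmc⟩ ham
  refine (ha.trans_lt hm).trans_le (ge_of_tendsto hl ?_)
  filter_upwards [Ioo_mem_nhdsLT hmc] with x hx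
  exact (hW ⟨ham.le, hmc⟩ ⟨(ham.trans hx.1).le, hx.2⟩ hx.1).le

/-- A strictly increasing function on `(c, b]` which is nonpositive at `b` has a negative right
limit at `c`. -/
theorem StrictMonoOn.neg_of_tendsto_right {W : ℝ → ℝ} {b c l : ℝ} (hW : StrictMonoOn W (Ioc c b))
    (hcb : c < b) (hb : W b ≤ 0) (hl : Tendsto W (𝓝[>] c) (𝓝 l)) : l < 0 := by
  obtain ⟨m, hcm, hmb⟩ := exists_between hcb
  have hm : W m < W b := hW ⟨hcm, hmb.le⟩ ⟨hcb, le_rfl⟩ hmb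
  refine (le_of_tendsto hl ?_).trans_lt (hm.trans_le hb)
  filter_upwards [Ioo_mem_nhdsGT hcm] with x hx
  exact (hW ⟨hx.1, (hx.2.trans hmb).le⟩ ⟨hcm, hmb.le⟩ hx.2).le

theorem Continuous.forall_pos_or_forall_neg {f : ℝ → ℝ} {s : Set ℝ} (hf : Continuous f)
    (hs : IsPreconnected s) (h : ∀ x ∈ s, f x ≠ 0) :
    (∀ x ∈ s, 0 < f x) ∨ ∀ x ∈ s, f x < 0 := by
  by_contra! hcon
  obtain ⟨⟨x, hx, hfx⟩, y, hy, hfy⟩ := hcon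
  obtain ⟨z, hz, hfz⟩ := hs.intermediate_value hx hy hf.continuousOn ⟨hfx, hfy⟩
  exact h z hz hfz

/-- The Wronskian argument: the eigenfunction for the larger eigenvalue is not positive
throughout a nodal interval of the one for the smaller eigenvalue. -/
theorem not_forall_pos_of_delta_interaction {γ lam₁ lam₂ : ℝ} {V φ₁ φ₂ : ℝ → ℝ}
    (hlam : lam₁ < lam₂)
    (h1cont : Continuous φ₁) (h1C2 : ContDiffOn ℝ 2 φ₁ {0}ᶜ) {L1p L1m : ℝ}
    (h1Lp : Tendsto (deriv φ₁) (𝓝[>] (0 : ℝ)) (𝓝 L1p))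
    (h1Lm : Tendsto (deriv φ₁) (𝓝[<] (0 : ℝ)) (𝓝 L1m))
    (h1jump : L1p - L1m = -γ * φ₁ 0)
    (h1eq : ∀ x ≠ 0, -(deriv (deriv φ₁) x) + V x * φ₁ x = lam₁ * φ₁ x)
    (h2cont : Continuous φ₂) (h2C2 : ContDiffOn ℝ 2 φ₂ {0}ᶜ) {L2p L2m : ℝ}
    (h2Lp : Tendsto (deriv φ₂) (𝓝[>] (0 : ℝ)) (𝓝 L2p))
    (h2Lm : Tendsto (deriv φ₂) (𝓝[<] (0 : ℝ)) (𝓝 L2m))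
    (h2jump : L2p - L2m = -γ * φ₂ 0)
    (h2eq : ∀ x ≠ 0, -(deriv (deriv φ₂) x) + V x * φ₂ x = lam₂ * φ₂ x)
    {a b : ℝ} (ha : a < 0) (hb : 0 < b) (h1a : φ₁ a = 0) (h1b : φ₁ b = 0)
    (h1pos : ∀ x ∈ Ioo a b, 0 < φ₁ x) : ¬ ∀ x ∈ Ioo a b, 0 < φ₂ x := by
  intro h2pos
  have hab : a < b := ha.trans hb
  have D1 (x : ℝ) (hx : x ≠ 0) := h1C2.hasDerivAt_deriv_of_isOpen isOpen_compl_singleton hx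
  have D2 (x : ℝ) (hx : x ≠ 0) := h2C2.hasDerivAt_deriv_of_isOpen isOpen_compl_singleton hx
  have h2nonneg : ∀ x ∈ Icc a b, 0 ≤ φ₂ x := by
    rw [← closure_Ioo hab.ne]
    exact fun x hx ↦ closure_minimal (t := {x | 0 ≤ φ₂ x}) (fun y hy ↦ (h2pos y hy).le)
      (isClosed_le continuous_const h2cont) hx
  set W : ℝ → ℝ := fun x ↦ deriv φ₁ x * φ₂ x - φ₁ x * deriv φ₂ x with hW
  have hWderiv (x : ℝ) (hx : x ≠ 0) :
      HasDerivAt W ((lam₂ - lam₁) * (φ₁ x * φ₂ x)) x := by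
    refine (((D1 x hx).2.mul (D2 x hx).1).sub ((D1 x hx).1.mul (D2 x hx).2)).congr_deriv ?_
    linear_combination φ₁ x * h2eq x hx - φ₂ x * h1eq x hx
  have hWpos (x : ℝ) (hx : x ≠ 0) (hxab : x ∈ Ioo a b) : 0 < deriv W x := by
    rw [(hWderiv x hx).deriv]
    exact mul_pos (sub_pos.2 hlam) (mul_pos (h1pos x hxab) (h2pos x hxab))
  have hleft : StrictMonoOn W (Ico a 0) := by
    refine strictMonoOn_of_deriv_pos (convex_Ico a 0)
      (fun x hx ↦ (hWderiv x hx.2.ne).continuousAt.continuousWithinAt) fun x hx ↦ ?_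
    rw [interior_Ico] at hx
    exact hWpos x hx.2.ne ⟨hx.1, hx.2.trans hb⟩
  have hright : StrictMonoOn W (Ioc 0 b) := by
    refine strictMonoOn_of_deriv_pos (convex_Ioc 0 b)
      (fun x hx ↦ (hWderiv x hx.1.ne').continuousAt.continuousWithinAt) fun x hx ↦ ?_
    rw [interior_Ioc] at hx
    exact hWpos x hx.1.ne' ⟨ha.trans hx.1, hx.2⟩
  have hWa : 0 ≤ W a := by
    have := (D1 a ha.ne).1.nonneg_of_nonneg_right hab h1a fun x hx ↦ (h1pos x hx).le
    simpa [hW, h1a] using mul_nonneg this (h2nonneg a ⟨le_rfl, hab.le⟩)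
  have hWb : W b ≤ 0 := by
    have := (D1 b hb.ne').1.nonpos_of_nonneg_left hab h1b fun x hx ↦ (h1pos x hx).le
    simpa [hW, h1b] using mul_nonpos_of_nonpos_of_nonneg this (h2nonneg b ⟨hab.le, le_rfl⟩)
  have hlim {s : Set ℝ} {l₁ l₂ : ℝ} (h₁ : Tendsto (deriv φ₁) (𝓝[s] 0) (𝓝 l₁))
      (h₂ : Tendsto (deriv φ₂) (𝓝[s] 0) (𝓝 l₂)) :
      Tendsto W (𝓝[s] 0) (𝓝 (l₁ * φ₂ 0 - φ₁ 0 * l₂)) :=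
    (h₁.mul h2cont.continuousWithinAt.tendsto).sub (h1cont.continuousWithinAt.tendsto.mul h₂)
  have hm := hleft.pos_of_tendsto_left ha hWa (hlim h1Lm h2Lm)
  have hp := hright.neg_of_tendsto_right hb hWb (hlim h1Lp h2Lp)
  have heq : L1p * φ₂ 0 - φ₁ 0 * L2p = L1m * φ₂ 0 - φ₁ 0 * L2m := by
    linear_combination φ₂ 0 * h1jump - φ₁ 0 * h2jump
  linarith

/-- Sturm oscillation comparison for Schrödinger operators `-d²/dx² + V(x)` with a
δ-interaction at the origin: if `φ₁, φ₂` are eigenfunctions for eigenvalues `λ₁ < λ₂`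
(both satisfying the jump condition `φ'(0⁺) - φ'(0⁻) = -γφ(0)`), and `φ₁` vanishes at
`a < 0 < b` while being positive on `(a,b)`, then `φ₂` vanishes somewhere in `(a,b)`. -/
theorem stmt8 (γ : ℝ) (V : ℝ → ℝ) (hV : Continuous V)
    (lam₁ lam₂ : ℝ) (hlam : lam₁ < lam₂)
    (φ₁ φ₂ : ℝ → ℝ)
    (h1cont : Continuous φ₁) (h1C2 : ContDiffOn ℝ 2 φ₁ {0}ᶜ)
    (L1p L1m : ℝ)
    (h1Lp : Tendsto (deriv φ₁) (𝓝[>] (0 : ℝ)) (𝓝 L1p))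
    (h1Lm : Tendsto (deriv φ₁) (𝓝[<] (0 : ℝ)) (𝓝 L1m))
    (h1jump : L1p - L1m = -γ * φ₁ 0)
    (h1eq : ∀ x ≠ 0, -(deriv (deriv φ₁) x) + V x * φ₁ x = lam₁ * φ₁ x)
    (h2cont : Continuous φ₂) (h2C2 : ContDiffOn ℝ 2 φ₂ {0}ᶜ)
    (L2p L2m : ℝ)
    (h2Lp : Tendsto (deriv φ₂) (𝓝[>] (0 : ℝ)) (𝓝 L2p))
    (h2Lm : Tendsto (deriv φ₂) (𝓝[<] (0 : ℝ)) (𝓝 L2m))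
    (h2jump : L2p - L2m = -γ * φ₂ 0)
    (h2eq : ∀ x ≠ 0, -(deriv (deriv φ₂) x) + V x * φ₂ x = lam₂ * φ₂ x)
    (a b : ℝ) (ha : a < 0) (hb : 0 < b)
    (h1a : φ₁ a = 0) (h1b : φ₁ b = 0)
    (h1pos : ∀ x ∈ Set.Ioo a b, 0 < φ₁ x) :
    ∃ c ∈ Set.Ioo a b, φ₂ c = 0 := by
  by_contra! hne
  rcases h2cont.forall_pos_or_forall_neg isPreconnected_Ioo hne with h2pos | h2neg
  · exact not_forall_pos_of_delta_interaction hlam h1cont h1C2 h1Lp h1Lm h1jump h1eq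
      h2cont h2C2 h2Lp h2Lm h2jump h2eq ha hb h1a h1b h1pos h2pos
  · have hderiv : deriv (fun x ↦ -φ₂ x) = fun x ↦ -deriv φ₂ x := deriv.fun_neg'
    refine not_forall_pos_of_delta_interaction (φ₂ := fun x ↦ -φ₂ x) (L2p := -L2p) (L2m := -L2m)
      hlam h1cont h1C2 h1Lp h1Lm h1jump h1eq h2cont.neg h2C2.neg (hderiv ▸ h2Lp.neg)
      (hderiv ▸ h2Lm.neg) (by linear_combination -h2jump) (fun x hx ↦ ?_) ha hb h1a h1b h1pos
      fun x hx ↦ neg_pos.2 (h2neg x hx)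
    rw [hderiv, deriv.fun_neg]
    linear_combination -h2eq x hx
end

section
/- Let γ ∈ ℝ, let V : ℝ → ℝ be continuous, and let λ₁ < λ₂ be real numbers. For i = 1,2 suppose φᵢ : ℝ → ℝ is continuous on ℝ, twice continuously differentiable on ℝ\{0}, the one-sided limits φᵢ'(0⁺), φᵢ'(0⁻) exist and satisfy φᵢ'(0⁺) - φᵢ'(0⁻) = -γ·φᵢ(0), the equation -φᵢ''(x) + V(x)·φᵢ(x) = λᵢ·φᵢ(x) holds for every x ≠ 0, and φᵢ(x) → 0 and φᵢ'(x) → 0 as x → +∞. Let a < 0 be such that φ₁(a) = 0 and φ₁(x) > 0 for all x ∈ (a, ∞), and assume the product φ₁·φ₂ is integrable on (a, ∞). Then there exists c ∈ (a, ∞) with φ₂(c) = 0. -/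
open MeasureTheory Filter Set Topology

/-- The first two derivatives of a function that is twice continuously differentiable away from
the origin. -/
lemma ContDiffOn.hasDerivAt_deriv_of_ne_zero {f : ℝ → ℝ} (hf : ContDiffOn ℝ 2 f {0}ᶜ) {x : ℝ}
    (hx : x ≠ 0) :
    HasDerivAt f (deriv f x) x ∧ HasDerivAt (deriv f) (deriv (deriv f) x) x := by
  have hxs : ({0}ᶜ : Set ℝ) ∈ 𝓝 x := isOpen_compl_singleton.mem_nhds hx
  have h1 : ContDiffOn ℝ 1 (deriv f) {0}ᶜ :=
    hf.deriv_of_isOpen isOpen_compl_singleton (by norm_num)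
  exact ⟨((hf.contDiffAt hxs).differentiableAt (by norm_num)).hasDerivAt,
    ((h1.contDiffAt hxs).differentiableAt (by norm_num)).hasDerivAt⟩

/-- A function that vanishes at `a` and is nonnegative to the right of `a` has nonnegative
derivative at `a`. -/
lemma HasDerivAt.nonneg_of_forall_gt_nonneg {f : ℝ → ℝ} {f' a : ℝ} (hf : HasDerivAt f f' a)
    (ha : f a = 0) (hpos : ∀ x ∈ Ioi a, 0 ≤ f x) : 0 ≤ f' := by
  have h := (hasDerivWithinAt_iff_tendsto_slope' (self_notMem_Ioi (a := a))).1
    (hf.hasDerivWithinAt (s := Ioi a))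
  refine ge_of_tendsto h ?_
  filter_upwards [self_mem_nhdsWithin] with x hx
  rw [slope_def_field, ha, sub_zero]
  exact div_nonneg (hpos x hx) (sub_nonneg.2 (le_of_lt hx))

/-- A function that is differentiable with positive derivative on `[a, ∞)` except at one interior
point `b`, where its one-sided limits agree, and that tends to `l` at `+∞`, is less than `l`
at `a`. -/
lemma lt_of_tendsto_atTop_of_deriv_pos_off_point {W W' : ℝ → ℝ} {a b l L : ℝ} (hab : a < b)
    (hW : ∀ x, a ≤ x → x ≠ b → HasDerivAt W (W' x) x)
    (hW' : ∀ x, a < x → x ≠ b → 0 < W' x)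
    (hp : Tendsto W (𝓝[>] b) (𝓝 L)) (hm : Tendsto W (𝓝[<] b) (𝓝 L))
    (hlim : Tendsto W atTop (𝓝 l)) : W a < l := by
  set U := Function.update W b L with hU
  have hUW : ∀ x, x ≠ b → U =ᶠ[𝓝 x] W := fun x hx ↦ by
    filter_upwards [isOpen_ne.mem_nhds hx] with y hy
    exact Function.update_of_ne hy _ _
  have hder : ∀ x, a ≤ x → x ≠ b → HasDerivAt U (W' x) x := fun x hax hx ↦
    (hW x hax hx).congr_of_eventuallyEq (hUW x hx)
  have hcont : ContinuousOn U (Ici a) := by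
    intro x hx
    refine ContinuousAt.continuousWithinAt ?_
    by_cases hxb : x = b
    · rw [hxb, hU, continuousAt_update_same, ← Iio_union_Ioi, nhdsWithin_union]
      exact hm.sup hp
    · exact (hder x hx hxb).continuousAt
  have hleft : StrictMonoOn U (Icc a b) := by
    refine strictMonoOn_of_deriv_pos (convex_Icc a b) (hcont.mono Icc_subset_Ici_self) ?_
    intro x hx
    rw [interior_Icc] at hx
    rw [(hder x hx.1.le hx.2.ne).deriv]
    exact hW' x hx.1 hx.2.ne
  have hright : StrictMonoOn U (Ici b) := by
    refine strictMonoOn_of_deriv_pos (convex_Ici b) (hcont.mono (Ici_subset_Ici.2 hab.le)) ?_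
    intro x hx
    rw [interior_Ici] at hx
    have hax : a < x := hab.trans hx
    rw [(hder x hax.le (ne_of_gt hx)).deriv]
    exact hW' x hax (ne_of_gt hx)
  have hab' : U a < U b := hleft (left_mem_Icc.2 hab.le) (right_mem_Icc.2 hab.le) hab
  have hbl : U b ≤ l := by
    refine ge_of_tendsto hlim ?_
    filter_upwards [eventually_gt_atTop b] with x hx
    have hlt : U b < U x := hright self_mem_Ici hx.le hx
    rw [(hUW x hx.ne').eq_of_nhds] at hlt
    exact hlt.le
  rw [(hUW a hab.ne).eq_of_nhds] at hab'
  exact hab'.trans_le hbl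

/-- No solution for the larger eigenvalue can be positive on `(a, ∞)` when a solution for the
smaller one vanishes at `a` and is positive on `(a, ∞)`: their Wronskian would be nonnegative at
`a`, strictly increasing, and would tend to `0` at `+∞`. -/
lemma not_forall_pos_of_delta_schrodinger {γ : ℝ} {V : ℝ → ℝ} {lam₁ lam₂ : ℝ}
    (hlam : lam₁ < lam₂) {φ₁ φ₂ : ℝ → ℝ}
    (h1cont : Continuous φ₁) (h1C2 : ContDiffOn ℝ 2 φ₁ {0}ᶜ) {L1p L1m : ℝ}
    (h1Lp : Tendsto (deriv φ₁) (𝓝[>] (0 : ℝ)) (𝓝 L1p))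
    (h1Lm : Tendsto (deriv φ₁) (𝓝[<] (0 : ℝ)) (𝓝 L1m))
    (h1jump : L1p - L1m = -γ * φ₁ 0)
    (h1eq : ∀ x ≠ 0, -(deriv (deriv φ₁) x) + V x * φ₁ x = lam₁ * φ₁ x)
    (h1decay : Tendsto φ₁ atTop (𝓝 0))
    (h1decay' : Tendsto (deriv φ₁) atTop (𝓝 0))
    (h2cont : Continuous φ₂) (h2C2 : ContDiffOn ℝ 2 φ₂ {0}ᶜ) {L2p L2m : ℝ}
    (h2Lp : Tendsto (deriv φ₂) (𝓝[>] (0 : ℝ)) (𝓝 L2p))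
    (h2Lm : Tendsto (deriv φ₂) (𝓝[<] (0 : ℝ)) (𝓝 L2m))
    (h2jump : L2p - L2m = -γ * φ₂ 0)
    (h2eq : ∀ x ≠ 0, -(deriv (deriv φ₂) x) + V x * φ₂ x = lam₂ * φ₂ x)
    (h2decay : Tendsto φ₂ atTop (𝓝 0))
    (h2decay' : Tendsto (deriv φ₂) atTop (𝓝 0))
    {a : ℝ} (ha : a < 0) (h1a : φ₁ a = 0) (h1pos : ∀ x ∈ Ioi a, 0 < φ₁ x) :
    ¬ ∀ x ∈ Ioi a, 0 < φ₂ x := by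
  intro h2pos
  have hder : ∀ x, a ≤ x → x ≠ 0 → HasDerivAt (fun x ↦ deriv φ₁ x * φ₂ x - φ₁ x * deriv φ₂ x)
      ((lam₂ - lam₁) * (φ₁ x * φ₂ x)) x := by
    intro x _ hx
    obtain ⟨h1, h1'⟩ := h1C2.hasDerivAt_deriv_of_ne_zero hx
    obtain ⟨h2, h2'⟩ := h2C2.hasDerivAt_deriv_of_ne_zero hx
    refine ((h1'.mul h2).sub (h1.mul h2')).congr_deriv ?_
    linear_combination φ₁ x * h2eq x hx - φ₂ x * h1eq x hx
  have h1r : Tendsto φ₁ (𝓝[>] 0) (𝓝 (φ₁ 0)) := h1cont.continuousAt.mono_left nhdsWithin_le_nhds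
  have h1l : Tendsto φ₁ (𝓝[<] 0) (𝓝 (φ₁ 0)) := h1cont.continuousAt.mono_left nhdsWithin_le_nhds
  have h2r : Tendsto φ₂ (𝓝[>] 0) (𝓝 (φ₂ 0)) := h2cont.continuousAt.mono_left nhdsWithin_le_nhds
  have h2l : Tendsto φ₂ (𝓝[<] 0) (𝓝 (φ₂ 0)) := h2cont.continuousAt.mono_left nhdsWithin_le_nhds
  have hL : L1m * φ₂ 0 - φ₁ 0 * L2m = L1p * φ₂ 0 - φ₁ 0 * L2p := by
    linear_combination φ₁ 0 * h2jump - φ₂ 0 * h1jump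
  have hlim : Tendsto (fun x ↦ deriv φ₁ x * φ₂ x - φ₁ x * deriv φ₂ x) atTop (𝓝 0) := by
    simpa using (h1decay'.mul h2decay).sub (h1decay.mul h2decay')
  have hlt := lt_of_tendsto_atTop_of_deriv_pos_off_point ha hder
    (fun x hx _ ↦ mul_pos (sub_pos.2 hlam) (mul_pos (h1pos x hx) (h2pos x hx)))
    ((h1Lp.mul h2r).sub (h1r.mul h2Lp)) (hL ▸ (h1Lm.mul h2l).sub (h1l.mul h2Lm)) hlim
  have hd : 0 ≤ deriv φ₁ a :=
    (h1C2.hasDerivAt_deriv_of_ne_zero ha.ne).1.nonneg_of_forall_gt_nonneg h1a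
      fun x hx ↦ (h1pos x hx).le
  have h2a : 0 ≤ φ₂ a := by
    refine ge_of_tendsto (h2cont.continuousAt.mono_left nhdsWithin_le_nhds :
      Tendsto φ₂ (𝓝[>] a) (𝓝 (φ₂ a))) ?_
    filter_upwards [self_mem_nhdsWithin] with x hx
    exact (h2pos x hx).le
  rw [h1a, zero_mul, sub_zero] at hlt
  exact hlt.not_ge (mul_nonneg hd h2a)

/-- Half-infinite interval Sturm oscillation comparison for Schrödinger operators
`-d²/dx² + V(x)` with a δ-interaction at the origin: if `φ₁, φ₂` are eigenfunctions for
eigenvalues `λ₁ < λ₂` (both satisfying the jump condition and decaying with their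
derivatives at `+∞`), `φ₁(a) = 0` for some `a < 0` and `φ₁ > 0` on `(a,∞)`, and `φ₁·φ₂`
is integrable on `(a,∞)`, then `φ₂` vanishes somewhere in `(a,∞)`. -/
theorem stmt9 (γ : ℝ) (V : ℝ → ℝ) (hV : Continuous V)
    (lam₁ lam₂ : ℝ) (hlam : lam₁ < lam₂)
    (φ₁ φ₂ : ℝ → ℝ)
    (h1cont : Continuous φ₁) (h1C2 : ContDiffOn ℝ 2 φ₁ {0}ᶜ)
    (L1p L1m : ℝ)
    (h1Lp : Tendsto (deriv φ₁) (𝓝[>] (0 : ℝ)) (𝓝 L1p))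
    (h1Lm : Tendsto (deriv φ₁) (𝓝[<] (0 : ℝ)) (𝓝 L1m))
    (h1jump : L1p - L1m = -γ * φ₁ 0)
    (h1eq : ∀ x ≠ 0, -(deriv (deriv φ₁) x) + V x * φ₁ x = lam₁ * φ₁ x)
    (h1decay : Tendsto φ₁ atTop (𝓝 0))
    (h1decay' : Tendsto (deriv φ₁) atTop (𝓝 0))
    (h2cont : Continuous φ₂) (h2C2 : ContDiffOn ℝ 2 φ₂ {0}ᶜ)
    (L2p L2m : ℝ)
    (h2Lp : Tendsto (deriv φ₂) (𝓝[>] (0 : ℝ)) (𝓝 L2p))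
    (h2Lm : Tendsto (deriv φ₂) (𝓝[<] (0 : ℝ)) (𝓝 L2m))
    (h2jump : L2p - L2m = -γ * φ₂ 0)
    (h2eq : ∀ x ≠ 0, -(deriv (deriv φ₂) x) + V x * φ₂ x = lam₂ * φ₂ x)
    (h2decay : Tendsto φ₂ atTop (𝓝 0))
    (h2decay' : Tendsto (deriv φ₂) atTop (𝓝 0))
    (a : ℝ) (ha : a < 0)
    (h1a : φ₁ a = 0)
    (h1pos : ∀ x ∈ Set.Ioi a, 0 < φ₁ x)
    (hint : IntegrableOn (fun x => φ₁ x * φ₂ x) (Set.Ioi a)) :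
    ∃ c ∈ Set.Ioi a, φ₂ c = 0 := by
  by_contra! hne
  have hsign : (∀ x ∈ Ioi a, 0 < φ₂ x) ∨ ∀ x ∈ Ioi a, 0 < -φ₂ x := by
    by_contra! h
    obtain ⟨⟨x, hx, hx0⟩, y, hy, hy0⟩ := h
    obtain ⟨c, hc, hc0⟩ := isPreconnected_Ioi.intermediate_value hx hy h2cont.continuousOn
      ⟨hx0, neg_nonpos.1 hy0⟩
    exact hne c hc hc0
  rcases hsign with hpos | hneg
  · exact not_forall_pos_of_delta_schrodinger hlam h1cont h1C2 h1Lp h1Lm h1jump h1eq h1decay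
      h1decay' h2cont h2C2 h2Lp h2Lm h2jump h2eq h2decay h2decay' ha h1a h1pos hpos
  · have hd : deriv (fun x ↦ -φ₂ x) = fun x ↦ -deriv φ₂ x := deriv.fun_neg'
    refine not_forall_pos_of_delta_schrodinger (φ₂ := fun x ↦ -φ₂ x) (L2p := -L2p) (L2m := -L2m)
      hlam h1cont h1C2 h1Lp h1Lm h1jump h1eq h1decay h1decay' h2cont.neg h2C2.neg
      (hd ▸ h2Lp.neg) (hd ▸ h2Lm.neg) (by linear_combination -h2jump) (fun x hx ↦ ?_)
      (by simpa using h2decay.neg) (by simpa [hd] using h2decay'.neg) ha h1a h1pos hneg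
    rw [hd, deriv.fun_neg]
    linear_combination -h2eq x hx
end

section
/- Let γ ∈ ℝ with γ ≠ 0. Then for every f : ℝ → ℂ that is continuous and differentiable, with f, its derivative f', and x ↦ x·f(x) all square-integrable on ℝ, the following inequality holds: ∫_ℝ |f'(x)|² dx + ∫_ℝ ((|x| + γ/2)² - 1)·|f(x)|² dx ≥ γ·|f(0)|². -/
open MeasureTheory Filter Set Topology

/-- If `f` and `x ↦ x • f x` are square-integrable, so is `f` with respect to the shifted quadratic
weight `(|x| + c) ^ 2 - 1`. -/
lemma integrable_shifted_weight_mul_norm_sq {f : ℝ → ℂ} (c : ℝ)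
    (hfL2 : Integrable (fun x => ‖f x‖ ^ 2)) (hxfL2 : Integrable (fun x => ‖x • f x‖ ^ 2))
    (hcont : Continuous f) :
    Integrable (fun x : ℝ => ((|x| + c) ^ 2 - 1) * ‖f x‖ ^ 2) := by
  refine ((hxfL2.const_mul 2).add (hfL2.const_mul (2 * c ^ 2 + 1))).mono'
    (by fun_prop) (ae_of_all _ fun x => ?_)
  simp only [Pi.add_apply, norm_smul, mul_pow, Real.norm_eq_abs, abs_mul, sq_abs, abs_pow, abs_norm]
  have h : |(|x| + c) ^ 2 - 1| ≤ 2 * x ^ 2 + (2 * c ^ 2 + 1) := by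
    rw [abs_le, ← sq_abs x]
    constructor <;> nlinarith [sq_nonneg (|x| + c), sq_nonneg (|x| - c), sq_nonneg |x|, sq_nonneg c]
  nlinarith [mul_le_mul_of_nonneg_right h (sq_nonneg ‖f x‖)]

/-- The half-line inequality, obtained by completing the square `‖f' + (x + c) f‖ ^ 2`. -/
lemma mul_norm_sq_zero_le_integral_Ioi {f : ℝ → ℂ} (c : ℝ) (hdiff : Differentiable ℝ f)
    (hfL2 : Integrable (fun x => ‖f x‖ ^ 2))
    (hf'L2 : Integrable (fun x => ‖deriv f x‖ ^ 2))
    (hxfL2 : Integrable (fun x => ‖x • f x‖ ^ 2)) :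
    c * ‖f 0‖ ^ 2 ≤
      ∫ x in Ioi (0 : ℝ), (‖deriv f x‖ ^ 2 + ((|x| + c) ^ 2 - 1) * ‖f x‖ ^ 2) := by
  have hcont := hdiff.continuous
  have hsum := hf'L2.add (integrable_shifted_weight_mul_norm_sq c hfL2 hxfL2 hcont)
  set g : ℝ → ℝ := fun x => (x + c) * ‖f x‖ ^ 2 with hg
  set g' : ℝ → ℝ := fun x => 1 * ‖f x‖ ^ 2 + (x + c) * (2 * inner ℝ (f x) (deriv f x)) with hg'
  have hderiv : ∀ x, HasDerivAt g (g' x) x := fun x =>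
    ((hasDerivAt_id x).add_const c).mul (hdiff x).hasDerivAt.norm_sq
  have hgint : Integrable g := by
    refine (hxfL2.add (hfL2.const_mul (1 + |c|))).mono'
      (by fun_prop) (ae_of_all _ fun x => ?_)
    simp only [hg, Pi.add_apply, norm_smul, mul_pow, Real.norm_eq_abs, abs_mul, sq_abs, abs_pow,
      abs_norm]
    have h : |x + c| ≤ x ^ 2 + (1 + |c|) := by
      rw [← sq_abs x]
      nlinarith [abs_add_le x c, sq_nonneg (|x| - 1), sq_nonneg |x|]
    nlinarith [mul_le_mul_of_nonneg_right h (sq_nonneg ‖f x‖)]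
  have hinner : ∀ x, |(x + c) * (2 * inner ℝ (f x) (deriv f x))| ≤
      ‖deriv f x‖ ^ 2 + (x + c) ^ 2 * ‖f x‖ ^ 2 := fun x => by
    have h := abs_real_inner_le_norm (f x) (deriv f x)
    rw [abs_mul, abs_mul, abs_two, ← sq_abs (x + c)]
    nlinarith [mul_le_mul_of_nonneg_left h (abs_nonneg (x + c)),
      sq_nonneg (‖deriv f x‖ - |x + c| * ‖f x‖)]
  have hg'int : Integrable g' := by
    refine (hfL2.const_mul 1).add (((hf'L2.add (hxfL2.const_mul 2)).add
      (hfL2.const_mul (2 * c ^ 2))).mono' ?_ (ae_of_all _ fun x => ?_))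
    · have hm : Measurable (deriv f) := measurable_deriv f
      have hfm : Measurable f := hcont.measurable
      exact Measurable.aestronglyMeasurable (by fun_prop)
    · refine (hinner x).trans ?_
      simp only [Pi.add_apply, norm_smul, mul_pow, Real.norm_eq_abs, sq_abs]
      nlinarith [mul_nonneg (sq_nonneg (x - c)) (sq_nonneg ‖f x‖)]
  have hlim : Tendsto g atTop (𝓝 0) :=
    tendsto_zero_of_hasDerivAt_of_integrableOn_Ioi (a := 0) (fun x _ => hderiv x)
      hg'int.integrableOn hgint.integrableOn
  have hftc := integral_Ioi_of_hasDerivAt_of_tendsto' (a := 0) (fun x _ => hderiv x)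
    hg'int.integrableOn hlim
  have h0 : c * ‖f 0‖ ^ 2 = ∫ x in Ioi (0 : ℝ), -g' x := by
    rw [integral_neg, hftc]; simp [hg]
  rw [h0]
  refine setIntegral_mono_on hg'int.neg.integrableOn hsum.integrableOn measurableSet_Ioi
    fun x hx => ?_
  rw [abs_of_pos hx]
  simp only [hg']
  linarith [neg_le_of_abs_le (hinner x)]

/-- Nonnegativity of the quadratic form of `L₂^γ = -d²/dx² + (|x|+γ/2)² - 1` with
δ-interaction of strength `γ ≠ 0`: for every `f` in the weighted space `W̃`,
`∫ |f'|² + ∫ ((|x|+γ/2)² - 1)|f|² ≥ γ|f(0)|²`. -/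
theorem stmt10 (γ : ℝ) (hγ : γ ≠ 0) (f : ℝ → ℂ)
    (hcont : Continuous f) (hdiff : Differentiable ℝ f)
    (hfL2 : Integrable (fun x => ‖f x‖ ^ 2))
    (hf'L2 : Integrable (fun x => ‖deriv f x‖ ^ 2))
    (hxfL2 : Integrable (fun x => ‖x • f x‖ ^ 2)) :
    (∫ x : ℝ, ‖deriv f x‖ ^ 2) + (∫ x : ℝ, ((|x| + γ / 2) ^ 2 - 1) * ‖f x‖ ^ 2)
      ≥ γ * ‖f 0‖ ^ 2 := by
  have hw := integrable_shifted_weight_mul_norm_sq (γ / 2) hfL2 hxfL2 hcont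
  have hpos := mul_norm_sq_zero_le_integral_Ioi (γ / 2) hdiff hfL2 hf'L2 hxfL2
  have hneg := mul_norm_sq_zero_le_integral_Ioi (f := fun x => f (-x)) (γ / 2)
    (hdiff.comp differentiable_neg) hfL2.comp_neg
    (by simpa only [deriv_comp_neg, norm_neg] using hf'L2.comp_neg)
    (by simpa only [neg_smul, norm_neg] using hxfL2.comp_neg)
  have hrefl := integral_comp_neg_Ioi (0 : ℝ)
    (fun x => ‖deriv f x‖ ^ 2 + ((|x| + γ / 2) ^ 2 - 1) * ‖f x‖ ^ 2)
  simp only [abs_neg, neg_zero] at hrefl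
  simp only [deriv_comp_neg, norm_neg, neg_zero] at hneg
  rw [hrefl] at hneg
  have hsplit := intervalIntegral.integral_Iic_add_Ioi
    (hf'L2.add hw).integrableOn (hf'L2.add hw).integrableOn (b := 0)
  simp only [Pi.add_apply] at hsplit
  rw [← integral_add hf'L2 hw]
  linarith
end

section
/- Let γ > 0. Then for every f : ℝ → ℂ that is continuous and differentiable with f, its derivative f', and x ↦ x·f(x) all square-integrable on ℝ, and such that f(0) = 0, the following inequality holds: ∫_ℝ |f'(x)|² dx + ∫_ℝ ((|x| + γ/2)² - 3)·|f(x)|² dx ≥ 0. -/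
open MeasureTheory Filter Set Topology

/-- The square of `w = 1 / y - y`, for `y = x + a`, and the size `1 / y ^ 2 + 1` of its
derivative are at most quadratic in `x ≥ 0`. -/
lemma sq_inv_sub_self_add_le {a x : ℝ} (ha : 0 < a) (hx : 0 ≤ x) :
    ((x + a)⁻¹ - (x + a)) ^ 2 + (((x + a) ^ 2)⁻¹ + 1) ≤
      2 * (a ^ 2)⁻¹ + 2 * a ^ 2 + 2 * x ^ 2 := by
  have hy : 0 < x + a := by linarith
  have hinv : ((x + a) ^ 2)⁻¹ ≤ (a ^ 2)⁻¹ := by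
    gcongr
    linarith
  have hsq : ((x + a)⁻¹ - (x + a)) ^ 2 = ((x + a) ^ 2)⁻¹ - 2 + (x + a) ^ 2 := by
    field_simp
    ring
  rw [hsq]
  nlinarith [sq_nonneg (x - a)]

/-- On the half-line, the quadratic form of `-d²/dx² + (x + a)² - 3` with Dirichlet condition at
the origin is nonnegative. -/
lemma integral_Ioi_shifted_oscillator_nonneg {a : ℝ} (ha : 0 < a) {g : ℝ → ℂ}
    (hdiff : Differentiable ℝ g)
    (hg : Integrable (fun x => ‖g x‖ ^ 2))
    (hg' : Integrable (fun x => ‖deriv g x‖ ^ 2))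
    (hxg : Integrable (fun x => ‖x • g x‖ ^ 2))
    (hg0 : g 0 = 0)
    (hG : Integrable (fun x => ‖deriv g x‖ ^ 2 + ((|x| + a) ^ 2 - 3) * ‖g x‖ ^ 2)) :
    0 ≤ ∫ x in Ioi (0 : ℝ), ‖deriv g x‖ ^ 2 + ((|x| + a) ^ 2 - 3) * ‖g x‖ ^ 2 := by
  set H : ℝ → ℝ := fun x => ((x + a)⁻¹ - (x + a)) * ‖g x‖ ^ 2 with hH
  set H' : ℝ → ℝ := fun x => (-1 / (x + a) ^ 2 - 1) * ‖g x‖ ^ 2 +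
    ((x + a)⁻¹ - (x + a)) * (2 * inner ℝ (g x) (deriv g x)) with hH'
  have hderiv : ∀ x, 0 ≤ x → HasDerivAt H (H' x) x := by
    intro x hx
    have hy : x + a ≠ 0 := by positivity
    have hid := (hasDerivAt_id x).add_const a
    exact ((hid.fun_inv hy).sub hid).mul (hdiff x).hasDerivAt.norm_sq
  set B : ℝ → ℝ := fun x => (2 * (a ^ 2)⁻¹ + 2 * a ^ 2) * ‖g x‖ ^ 2 + 2 * ‖x • g x‖ ^ 2 +
    ‖deriv g x‖ ^ 2 with hB
  have hBint : IntegrableOn B (Ioi 0) :=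
    (((hg.const_mul _).add (hxg.const_mul 2)).add hg').integrableOn
  have hBeq : ∀ x, B x = (2 * (a ^ 2)⁻¹ + 2 * a ^ 2 + 2 * x ^ 2) * ‖g x‖ ^ 2 +
      ‖deriv g x‖ ^ 2 := by
    intro x
    simp only [hB, norm_smul, mul_pow, Real.norm_eq_abs, sq_abs]
    ring
  have hgm : Measurable g := hdiff.continuous.measurable
  have hg'm : Measurable (deriv g) := measurable_deriv g
  have hHint : IntegrableOn H (Ioi 0) := by
    refine Integrable.mono' hBint (by fun_prop) ?_
    filter_upwards [ae_restrict_mem measurableSet_Ioi] with x hx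
    rw [hBeq, hH, norm_mul, Real.norm_eq_abs, norm_pow, norm_norm]
    have h := sq_inv_sub_self_add_le ha (le_of_lt hx)
    have hw : |(x + a)⁻¹ - (x + a)| ≤ 2 * (a ^ 2)⁻¹ + 2 * a ^ 2 + 2 * x ^ 2 := by
      have hinv : 0 ≤ ((x + a) ^ 2)⁻¹ := by positivity
      have habs := sq_abs ((x + a)⁻¹ - (x + a))
      nlinarith [sq_nonneg (|(x + a)⁻¹ - (x + a)| - 1)]
    have := mul_le_mul_of_nonneg_right hw (sq_nonneg ‖g x‖)
    linarith [sq_nonneg ‖deriv g x‖]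
  have hH'int : IntegrableOn H' (Ioi 0) := by
    refine Integrable.mono' hBint (by fun_prop) ?_
    filter_upwards [ae_restrict_mem measurableSet_Ioi] with x hx
    have h := mul_le_mul_of_nonneg_right (sq_inv_sub_self_add_le ha (le_of_lt hx))
      (sq_nonneg ‖g x‖)
    have hinv : 0 ≤ ((x + a) ^ 2)⁻¹ * ‖g x‖ ^ 2 := by positivity
    have hadd := norm_add_sq_real (((x + a)⁻¹ - (x + a)) • g x) (deriv g x)
    have hsub := norm_sub_sq_real (((x + a)⁻¹ - (x + a)) • g x) (deriv g x)
    rw [real_inner_smul_left, norm_smul, mul_pow, Real.norm_eq_abs, sq_abs] at hadd hsub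
    rw [hBeq, Real.norm_eq_abs, abs_le]
    simp only [hH', neg_div, one_div]
    constructor
    · nlinarith [sq_nonneg ‖((x + a)⁻¹ - (x + a)) • g x + deriv g x‖]
    · nlinarith [sq_nonneg ‖((x + a)⁻¹ - (x + a)) • g x - deriv g x‖, sq_nonneg ‖g x‖]
  have hlim : Tendsto H atTop (𝓝 0) :=
    tendsto_zero_of_hasDerivAt_of_integrableOn_Ioi (fun x hx => hderiv x (le_of_lt hx))
      hH'int hHint
  have hzero : ∫ x in Ioi (0 : ℝ), H' x = 0 := by
    rw [integral_Ioi_of_hasDerivAt_of_tendsto' (fun x hx => hderiv x hx) hH'int hlim]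
    simp [hH, hg0]
  refine hzero.ge.trans ?_
  refine setIntegral_mono_on hH'int hG.integrableOn measurableSet_Ioi fun x hx => ?_
  have hx : 0 < x := hx
  have hsub := norm_sub_sq_real (((x + a)⁻¹ - (x + a)) • g x) (deriv g x)
  rw [real_inner_smul_left, norm_smul, mul_pow, Real.norm_eq_abs, sq_abs] at hsub
  have hriccati : -1 / (x + a) ^ 2 - 1 + ((x + a)⁻¹ - (x + a)) ^ 2 = (x + a) ^ 2 - 3 := by
    have hy : x + a ≠ 0 := by positivity
    field_simp
    ring
  rw [abs_of_pos hx, ← hriccati]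
  simp only [hH']
  nlinarith [sq_nonneg ‖((x + a)⁻¹ - (x + a)) • g x - deriv g x‖]

/-- For `γ > 0`, the quadratic form of `L₀ = -d²/dx² + (|x|+γ/2)² - 3` is nonnegative on
functions in the weighted space `W̃` vanishing at the origin:
`∫ |f'|² + ∫ ((|x|+γ/2)² - 3)|f|² ≥ 0` whenever `f(0) = 0`. -/
theorem stmt11 (γ : ℝ) (hγ : 0 < γ) (f : ℝ → ℂ)
    (hcont : Continuous f) (hdiff : Differentiable ℝ f)
    (hfL2 : Integrable (fun x => ‖f x‖ ^ 2))
    (hf'L2 : Integrable (fun x => ‖deriv f x‖ ^ 2))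
    (hxfL2 : Integrable (fun x => ‖x • f x‖ ^ 2))
    (hf0 : f 0 = 0) :
    (∫ x : ℝ, ‖deriv f x‖ ^ 2) + (∫ x : ℝ, ((|x| + γ / 2) ^ 2 - 3) * ‖f x‖ ^ 2)
      ≥ 0 := by
  have ha : 0 < γ / 2 := by positivity
  have hpot : Integrable (fun x : ℝ => ((|x| + γ / 2) ^ 2 - 3) * ‖f x‖ ^ 2) := by
    refine Integrable.mono' ((hfL2.const_mul (2 * (γ / 2) ^ 2 + 3)).add (hxfL2.const_mul 2))
      (by fun_prop) (Eventually.of_forall fun x => ?_)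
    simp only [Pi.add_apply, norm_mul, norm_smul, mul_pow, norm_pow,
      Real.norm_eq_abs, abs_norm]
    have hw : |(|x| + γ / 2) ^ 2 - 3| ≤ 2 * (γ / 2) ^ 2 + 3 + 2 * |x| ^ 2 := by
      rw [abs_le]
      constructor <;> nlinarith [sq_nonneg (|x| - γ / 2), sq_nonneg (|x| + γ / 2)]
    linarith [mul_le_mul_of_nonneg_right hw (sq_nonneg ‖f x‖)]
  have hG : Integrable (fun x => ‖deriv f x‖ ^ 2 + ((|x| + γ / 2) ^ 2 - 3) * ‖f x‖ ^ 2) :=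
    hf'L2.add hpot
  have hright := integral_Ioi_shifted_oscillator_nonneg ha hdiff hfL2 hf'L2 hxfL2 hf0 hG
  have hleft := integral_Ioi_shifted_oscillator_nonneg ha (g := fun x => f (-x))
    (hdiff.comp differentiable_neg) hfL2.comp_neg
    (by simpa [deriv_comp_neg] using hf'L2.comp_neg)
    (by simpa [norm_smul] using hxfL2.comp_neg) (by simpa using hf0)
    (by simpa [deriv_comp_neg] using hG.comp_neg)
  have hreflect := integral_comp_neg_Ioi (0 : ℝ)
    (fun x => ‖deriv f x‖ ^ 2 + ((|x| + γ / 2) ^ 2 - 3) * ‖f x‖ ^ 2)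
  simp only [deriv_comp_neg, norm_neg] at hleft
  simp only [abs_neg, neg_zero] at hreflect
  rw [hreflect] at hleft
  rw [← integral_add hf'L2 hpot,
    ← intervalIntegral.integral_Iic_add_Ioi (b := 0) hG.integrableOn hG.integrableOn]
  exact add_nonneg hleft hright
end

section
/- Let ω ∈ ℝ and γ ∈ ℝ with γ ≠ 0, and let φ_{ω,γ}(x) = e^{(ω+1)/2} · e^{-(|x|+γ/2)²/2}. Then φ_{ω,γ} satisfies -φ_{ω,γ}''(x) + ((|x| + γ/2)² - 3)·φ_{ω,γ}(x) = -2·φ_{ω,γ}(x) for every x ≠ 0, together with the jump condition φ_{ω,γ}'(0⁺) - φ_{ω,γ}'(0⁻) = -γ·φ_{ω,γ}(0). -/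
open MeasureTheory Filter Set Topology

/-- Away from the origin, `x ↦ C e^{-(|x|+a)²/2}` has derivative `-sign(x) (|x|+a) C e^{-(|x|+a)²/2}`. -/
theorem hasDerivAt_peak_gaussian {C a : ℝ} {φ : ℝ → ℝ}
    (hφ : ∀ x, φ x = C * Real.exp (-(|x| + a) ^ 2 / 2)) {x : ℝ} (hx : x ≠ 0) :
    HasDerivAt φ (-(SignType.sign x : ℝ) * (|x| + a) * φ x) x := by
  rw [show φ = fun y => C * Real.exp (-(|y| + a) ^ 2 / 2) from funext hφ]
  refine ((((((hasDerivAt_abs hx).add_const a).fun_pow 2).fun_neg.div_const 2).exp).const_mul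
    C).congr_deriv ?_
  ring

/-- The sign function is locally constant away from the origin. -/
theorem eventually_sign_eq {x : ℝ} (hx : x ≠ 0) :
    ∀ᶠ y in 𝓝 x, y ≠ 0 ∧ SignType.sign y = SignType.sign x := by
  rcases hx.lt_or_gt with h | h
  · filter_upwards [Iio_mem_nhds h] with y hy
    exact ⟨ne_of_lt hy, by rw [sign_neg hy, sign_neg h]⟩
  · filter_upwards [Ioi_mem_nhds h] with y hy
    exact ⟨ne_of_gt hy, by rw [sign_pos hy, sign_pos h]⟩

/-- Away from the origin, `φ(x) = C e^{-(|x|+a)²/2}` satisfies `φ'' = ((|x|+a)² - 1) φ`. -/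
theorem deriv_deriv_peak_gaussian {C a : ℝ} {φ : ℝ → ℝ}
    (hφ : ∀ x, φ x = C * Real.exp (-(|x| + a) ^ 2 / 2)) {x : ℝ} (hx : x ≠ 0) :
    deriv (deriv φ) x = ((|x| + a) ^ 2 - 1) * φ x := by
  have hderiv : deriv φ =ᶠ[𝓝 x] fun y => -(SignType.sign x : ℝ) * (|y| + a) * φ y := by
    filter_upwards [eventually_sign_eq hx] with y hy
    rw [(hasDerivAt_peak_gaussian hφ hy.1).deriv, hy.2]
  have hsign : (SignType.sign x : ℝ) ^ 2 = 1 := by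
    rcases hx.lt_or_gt with h | h <;> simp [h]
  rw [hderiv.deriv_eq, ((((hasDerivAt_abs hx).add_const a).const_mul _).fun_mul
    (hasDerivAt_peak_gaussian hφ hx)).deriv]
  linear_combination ((|x| + a) ^ 2 - 1) * φ x * hsign

/-- The peak-Gausson profile `φ_{ω,γ}(x) = e^{(ω+1)/2} e^{-(|x|+γ/2)²/2}` is an
eigenfunction of `L₁^γ = -d²/dx² + (|x|+γ/2)² - 3` with eigenvalue `-2`: it satisfies
`-φ'' + ((|x|+γ/2)² - 3)φ = -2φ` for `x ≠ 0` together with the jump condition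
`φ'(0⁺) - φ'(0⁻) = -γφ(0)`. -/
theorem stmt12 (ω γ : ℝ) (hγ : γ ≠ 0) (φ : ℝ → ℝ)
    (hφ : ∀ x, φ x = Real.exp ((ω + 1) / 2) * Real.exp (-(|x| + γ / 2) ^ 2 / 2)) :
    (∀ x ≠ 0, -(deriv (deriv φ) x) + ((|x| + γ / 2) ^ 2 - 3) * φ x = -2 * φ x) ∧
    (∃ Lp Lm : ℝ,
      Tendsto (deriv φ) (𝓝[>] (0 : ℝ)) (𝓝 Lp) ∧
      Tendsto (deriv φ) (𝓝[<] (0 : ℝ)) (𝓝 Lm) ∧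
      Lp - Lm = -γ * φ 0) := by
  have hcont : Continuous fun x => (|x| + γ / 2) * φ x := by
    rw [show φ = _ from funext hφ]
    fun_prop
  have hlim : Tendsto (fun x => (|x| + γ / 2) * φ x) (𝓝 0) (𝓝 (γ / 2 * φ 0)) := by
    simpa using hcont.tendsto 0
  refine ⟨fun x hx => ?_, -(γ / 2 * φ 0), γ / 2 * φ 0, ?_, ?_, by ring⟩
  · rw [deriv_deriv_peak_gaussian hφ hx]
    ring
  · refine (hlim.neg.mono_left nhdsWithin_le_nhds).congr' ?_
    filter_upwards [self_mem_nhdsWithin] with x hx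
    rw [(hasDerivAt_peak_gaussian hφ (ne_of_gt hx)).deriv, sign_pos hx]
    simp
    ring
  · refine (hlim.mono_left nhdsWithin_le_nhds).congr' ?_
    filter_upwards [self_mem_nhdsWithin] with x hx
    rw [(hasDerivAt_peak_gaussian hφ (ne_of_lt hx)).deriv, sign_neg hx]
    simp
end

section
/- Let γ ∈ ℝ. The set of functions u : ℝ → ℂ such that u is continuous on ℝ, twice continuously differentiable on ℝ\{0}, square-integrable on ℝ, and satisfies -u''(x) + ((|x| + γ/2)² - 3)·u(x) = i·u(x) for every x ≠ 0, is a complex vector space of dimension 1. -/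
open MeasureTheory Filter Set Topology

/-- The integrand of the integral representation of the Hermite function of order `-1 + i/2` and
of its derivatives. -/
noncomputable def hermiteKernel (k : ℕ) (y t : ℝ) : ℂ :=
  (t : ℂ) ^ k * (t : ℂ) ^ (-Complex.I / 2) * Complex.exp ((-t ^ 2 - 2 * y * t : ℝ) : ℂ)

/-- Up to the factor `(-2) ^ k`, the `k`-th derivative of a multiple of the Hermite function of
order `-1 + i/2`. -/
noncomputable def hermiteMoment (k : ℕ) (y : ℝ) : ℂ :=
  ∫ t in Ioi (0 : ℝ), hermiteKernel k y t

lemma norm_hermiteKernel {t : ℝ} (ht : 0 < t) (k : ℕ) (y : ℝ) :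
    ‖hermiteKernel k y t‖ = t ^ k * Real.exp (-t ^ 2 - 2 * y * t) := by
  have h : ‖(t : ℂ) ^ (-Complex.I / 2)‖ = 1 := by
    rw [Complex.norm_cpow_eq_rpow_re_of_pos ht]
    simp
  rw [hermiteKernel, norm_mul, norm_mul, h, Complex.norm_exp_ofReal, norm_pow, Complex.norm_real,
    Real.norm_of_nonneg ht.le, mul_one]

lemma norm_hermiteKernel_le {t c y : ℝ} (ht : 0 < t) (k : ℕ) (hy : -c ≤ y) :
    ‖hermiteKernel k y t‖ ≤
      Real.exp (2 * c ^ 2) * (t ^ (k : ℝ) * Real.exp (-(1 / 2) * t ^ 2)) := by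
  rw [norm_hermiteKernel ht, Real.rpow_natCast, mul_left_comm, ← Real.exp_add]
  gcongr
  nlinarith [sq_nonneg (t - 2 * c), mul_le_mul_of_nonneg_right hy ht.le]

lemma integrable_hermiteKernel_bound (k : ℕ) (c : ℝ) :
    IntegrableOn (fun t : ℝ => Real.exp (2 * c ^ 2) *
      (t ^ (k : ℝ) * Real.exp (-(1 / 2) * t ^ 2))) (Ioi 0) :=
  ((integrable_rpow_mul_exp_neg_mul_sq (by norm_num)
    (by linarith [Nat.cast_nonneg (α := ℝ) k])).const_mul _).integrableOn

lemma aestronglyMeasurable_hermiteKernel (k : ℕ) (y : ℝ) :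
    AEStronglyMeasurable (hermiteKernel k y) (volume.restrict (Ioi 0)) := by
  unfold hermiteKernel
  exact Measurable.aestronglyMeasurable (by fun_prop)

lemma integrableOn_hermiteKernel (k : ℕ) (y : ℝ) :
    IntegrableOn (hermiteKernel k y) (Ioi 0) := by
  refine (integrable_hermiteKernel_bound k (-y)).mono' (aestronglyMeasurable_hermiteKernel k y) ?_
  filter_upwards [ae_restrict_mem measurableSet_Ioi] with t ht
  exact norm_hermiteKernel_le ht k (by simp)

lemma hasDerivAt_hermiteMoment (k : ℕ) (y : ℝ) :
    HasDerivAt (hermiteMoment k) (-2 * hermiteMoment (k + 1) y) y := by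
  have key := hasDerivAt_integral_of_dominated_loc_of_deriv_le (μ := volume.restrict (Ioi (0 : ℝ)))
    (F := hermiteKernel k) (F' := fun z t => -2 * hermiteKernel (k + 1) z t)
    (s := Ioi (y - 1)) (Ioi_mem_nhds (by linarith))
    (.of_forall fun z => aestronglyMeasurable_hermiteKernel k z)
    (integrableOn_hermiteKernel k y)
    ((aestronglyMeasurable_hermiteKernel (k + 1) y).const_mul _)
    (bound := fun t => 2 * (Real.exp (2 * (1 - y) ^ 2) *
      (t ^ ((k + 1 : ℕ) : ℝ) * Real.exp (-(1 / 2) * t ^ 2))))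
    ?_ ((integrable_hermiteKernel_bound (k + 1) (1 - y)).const_mul 2) ?_
  · convert! key.2 using 1
    rw [integral_const_mul, hermiteMoment]
  · filter_upwards [ae_restrict_mem measurableSet_Ioi] with t ht z hz
    rw [norm_mul, norm_neg, Complex.norm_ofNat]
    have : y - 1 < z := hz
    exact mul_le_mul_of_nonneg_left (norm_hermiteKernel_le ht _ (by linarith)) (by norm_num)
  · filter_upwards with t z _
    have h : HasDerivAt (fun z : ℝ => -t ^ 2 - 2 * z * t) (-(2 * t)) z := by
      simpa using (((hasDerivAt_id z).const_mul 2).mul_const t).const_sub (-t ^ 2)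
    have := (h.ofReal_comp.cexp).const_mul ((t : ℂ) ^ k * (t : ℂ) ^ (-Complex.I / 2))
    refine this.congr_deriv ?_
    simp only [hermiteKernel]
    push_cast
    ring

lemma hasDerivAt_hermiteKernel_one {t : ℝ} (ht : 0 < t) (y : ℝ) :
    HasDerivAt (hermiteKernel 1 y) ((1 - Complex.I / 2) * hermiteKernel 0 y t
      - 2 * hermiteKernel 2 y t - 2 * y * hermiteKernel 1 y t) t := by
  have h₁ : HasDerivAt (fun t : ℝ => -t ^ 2 - 2 * y * t) (-(2 * t) - 2 * y) t := by
    convert! ((hasDerivAt_pow 2 t).neg).sub ((hasDerivAt_id t).const_mul (2 * y)) using 1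
    simp
  have ht' : (t : ℂ) ≠ 0 := by exact_mod_cast ht.ne'
  have h₂ : HasDerivAt (fun t : ℝ => (t : ℂ) ^ (-Complex.I / 2))
      ((-Complex.I / 2) * (t : ℂ) ^ (-Complex.I / 2 - 1)) t := by
    simpa using ((hasDerivAt_id (t : ℂ)).cpow_const (c := -Complex.I / 2)
      (Or.inl (by simpa using ht))).comp_ofReal
  have h₃ : HasDerivAt (fun t : ℝ => (t : ℂ) ^ 1) 1 t := by
    simpa using (hasDerivAt_id t).ofReal_comp
  refine ((h₃.mul h₂).mul h₁.ofReal_comp.cexp).congr_deriv ?_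
  simp only [hermiteKernel, Pi.mul_apply]
  rw [Complex.cpow_sub _ _ ht', Complex.cpow_one]
  push_cast
  field_simp
  ring

lemma one_sub_I_div_two_ne_zero : (1 - Complex.I / 2 : ℂ) ≠ 0 := fun h => by
  simpa using congrArg Complex.re h

lemma hermiteMoment_recurrence (y : ℝ) :
    (1 - Complex.I / 2) * hermiteMoment 0 y - 2 * hermiteMoment 2 y - 2 * y * hermiteMoment 1 y
      = 0 := by
  have hInt (k : ℕ) := integrableOn_hermiteKernel k y
  have hInt' : IntegrableOn (fun t => (1 - Complex.I / 2) * hermiteKernel 0 y t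
      - 2 * hermiteKernel 2 y t - 2 * y * hermiteKernel 1 y t) (Ioi 0) :=
    (((hInt 0).const_mul _).sub ((hInt 2).const_mul _)).sub ((hInt 1).const_mul _)
  have hderiv : ∀ t ∈ Ioi (0 : ℝ), HasDerivAt (hermiteKernel 1 y) _ t :=
    fun t ht => hasDerivAt_hermiteKernel_one ht y
  have hcont : ContinuousWithinAt (hermiteKernel 1 y) (Ici 0) 0 := by
    have h : Continuous fun t : ℝ => (t : ℂ) ^ (1 - Complex.I / 2) *
        Complex.exp ((-t ^ 2 - 2 * y * t : ℝ) : ℂ) :=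
      (Complex.continuous_ofReal_cpow_const (by simp)).mul (by fun_prop)
    refine h.continuousWithinAt.congr (fun t ht => ?_) ?_
    · rcases (show (0 : ℝ) ≤ t from ht).eq_or_lt with rfl | ht
      · simp [hermiteKernel, Complex.zero_cpow one_sub_I_div_two_ne_zero]
      · have ht' : (t : ℂ) ≠ 0 := by exact_mod_cast ht.ne'
        rw [hermiteKernel, sub_eq_add_neg 1, Complex.cpow_add _ _ ht', Complex.cpow_one, pow_one,
          neg_div]
    · simp [hermiteKernel, Complex.zero_cpow one_sub_I_div_two_ne_zero]
  have hlim : Tendsto (hermiteKernel 1 y) atTop (𝓝 0) :=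
    tendsto_zero_of_hasDerivAt_of_integrableOn_Ioi hderiv hInt' (hInt 1)
  have key := integral_Ioi_of_hasDerivAt_of_tendsto hcont hderiv hInt' hlim
  rw [integral_sub (f := fun t => (1 - Complex.I / 2) * hermiteKernel 0 y t
      - 2 * hermiteKernel 2 y t) (((hInt 0).const_mul _).sub ((hInt 2).const_mul _))
      ((hInt 1).const_mul _),
    integral_sub ((hInt 0).const_mul _) ((hInt 2).const_mul _), integral_const_mul,
    integral_const_mul, integral_const_mul] at key
  simpa [hermiteMoment, hermiteKernel] using key

lemma hermiteMoment_zero_zero_ne_zero : hermiteMoment 0 0 ≠ 0 := by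
  have h : hermiteMoment 0 0 = mellin (fun t : ℝ => ((Real.exp (-t ^ (2 : ℝ)) : ℝ) : ℂ))
      (1 - Complex.I / 2) := by
    rw [hermiteMoment, mellin]
    refine setIntegral_congr_fun measurableSet_Ioi fun t _ => ?_
    simp [hermiteKernel, neg_div]
  rw [h, mellin_comp_rpow (fun t : ℝ => ((Real.exp (-t) : ℝ) : ℂ)),
    ← Complex.GammaIntegral_eq_mellin, ← Complex.Gamma_eq_integral (by simp)]
  refine smul_ne_zero (by norm_num) (Complex.Gamma_ne_zero_of_re_pos (by simp))

lemma isBigO_hermiteMoment (k : ℕ) : hermiteMoment k =O[atTop] (fun _ : ℝ => (1 : ℝ)) := by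
  refine Asymptotics.IsBigO.of_bound (∫ t in Ioi (0 : ℝ), Real.exp (2 * 0 ^ 2) *
      (t ^ (k : ℝ) * Real.exp (-(1 / 2) * t ^ 2))) ?_
  filter_upwards [eventually_ge_atTop 0] with y hy
  rw [norm_one, mul_one]
  refine norm_integral_le_of_norm_le (integrable_hermiteKernel_bound k 0) ?_
  filter_upwards [ae_restrict_mem measurableSet_Ioi] with t ht
  exact norm_hermiteKernel_le ht k (by simpa using hy)

/-- `v` solves the Hermite equation `v'' = 2 y v' - 2 ν v`, with derivative `v'`. -/
structure IsHermiteSolution (ν : ℂ) (v v' : ℝ → ℂ) : Prop where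
  hasDerivAt : ∀ y, HasDerivAt v (v' y) y
  hasDerivAt' : ∀ y, HasDerivAt v' (2 * y * v' y - 2 * ν * v y) y

namespace IsHermiteSolution

variable {ν : ℂ} {v v' : ℝ → ℂ}

lemma raise (h : IsHermiteSolution ν v v') :
    IsHermiteSolution (ν + 1) (fun y => 2 * y * v y - v' y) (fun y => 2 * (ν + 1) * v y) where
  hasDerivAt y := by
    have hy : HasDerivAt (fun y : ℝ => (2 * y : ℂ)) 2 y := by
      simpa using (hasDerivAt_id y).ofReal_comp.const_mul (2 : ℂ)
    refine ((hy.mul (h.hasDerivAt y)).sub (h.hasDerivAt' y)).congr_deriv ?_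
    ring
  hasDerivAt' y := by
    refine ((h.hasDerivAt y).const_mul (2 * (ν + 1))).congr_deriv ?_
    ring

lemma deriv_eqOn_zero (h : IsHermiteSolution ν v v') {X : ℝ} (hv : EqOn v 0 (Ioi X)) :
    EqOn v' 0 (Ioi X) := fun y hy =>
  (h.hasDerivAt y).unique
    ((hasDerivAt_const y (0 : ℂ)).congr_of_eventuallyEq
      (hv.eventuallyEq_of_mem (Ioi_mem_nhds hy)))

lemma eqOn_zero_of_raise (h : IsHermiteSolution ν v v') (hν : ν + 1 ≠ 0) {X : ℝ}
    (hv : EqOn (fun y : ℝ => 2 * y * v y - v' y) 0 (Ioi X)) : EqOn v 0 (Ioi X) := fun y hy => by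
  simpa [hν] using h.raise.deriv_eqOn_zero hv hy

lemma apply_zero_eq_zero (h : IsHermiteSolution ν v v') {b : ℝ} (hb : 0 ≤ b) (hv : v b = 0)
    (hv' : v' b = 0) : v 0 = 0 := by
  let F : ℝ → ℂ × ℂ → ℂ × ℂ := fun t p => (p.2, 2 * t * p.2 - 2 * ν * p.1)
  have hF : ∀ t ∈ Ioc 0 b, LipschitzOnWith (1 + 2 * b + 2 * ‖ν‖).toNNReal (F t) univ := by
    intro t ht
    refine LipschitzWith.lipschitzOnWith (LipschitzWith.of_dist_le_mul fun p q => ?_)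
    have h₁ : ‖p.1 - q.1‖ ≤ ‖p - q‖ := norm_fst_le (p - q)
    have h₂ : ‖p.2 - q.2‖ ≤ ‖p - q‖ := norm_snd_le (p - q)
    rw [Real.coe_toNNReal _ (by positivity), dist_eq_norm, dist_eq_norm, Prod.norm_def]
    refine max_le ?_ ?_
    · refine h₂.trans (le_mul_of_one_le_left (norm_nonneg _) ?_)
      linarith [norm_nonneg ν]
    · have e : (F t p - F t q).2 = 2 * t * (p.2 - q.2) - 2 * ν * (p.1 - q.1) := by
        simp only [F, Prod.snd_sub]
        ring
      calc ‖(F t p - F t q).2‖ ≤ 2 * t * ‖p.2 - q.2‖ + 2 * ‖ν‖ * ‖p.1 - q.1‖ := by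
            rw [e]
            refine (norm_sub_le _ _).trans_eq ?_
            simp [abs_of_pos ht.1]
        _ ≤ 2 * b * ‖p - q‖ + 2 * ‖ν‖ * ‖p - q‖ := by
            have := ht.2
            gcongr
        _ ≤ (1 + 2 * b + 2 * ‖ν‖) * ‖p - q‖ := by
            linarith [norm_nonneg (p - q)]
  have hd : ∀ t, HasDerivAt (fun t => (v t, v' t)) (F t (v t, v' t)) t := fun t =>
    (h.hasDerivAt t).prodMk (h.hasDerivAt' t)
  have key := ODE_solution_unique_of_mem_Icc_left (g := fun _ => (0 : ℂ × ℂ)) hF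
    (fun t _ => (hd t).continuousAt.continuousWithinAt) (fun t _ => (hd t).hasDerivWithinAt)
    (fun _ _ => mem_univ _) continuousOn_const
    (fun t _ => ((hasDerivAt_const t (0 : ℂ × ℂ)).congr_deriv
      (Prod.ext (by simp [F]) (by simp [F]))).hasDerivWithinAt)
    (fun _ _ => mem_univ _) (by simp [hv, hv'])
  simpa using congrArg Prod.fst (key (left_mem_Icc.2 hb))

end IsHermiteSolution

lemma isHermiteSolution_hermiteMoment :
    IsHermiteSolution (-1 + Complex.I / 2) (hermiteMoment 0) (fun y => -2 * hermiteMoment 1 y) where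
  hasDerivAt y := hasDerivAt_hermiteMoment 0 y
  hasDerivAt' y := by
    refine ((hasDerivAt_hermiteMoment 1 y).const_mul (-2)).congr_deriv ?_
    linear_combination -2 * hermiteMoment_recurrence y

/-- `ψ` solves `ψ'' = ((x + a)² - 3 - i) ψ` on `ℝ` with derivative `ψ'`, both decay
exponentially at `+∞`, and `ψ` does not vanish identically near `+∞`. -/
structure IsDecayingSolution (a : ℝ) (ψ ψ' : ℝ → ℂ) : Prop where
  hasDerivAt : ∀ x, HasDerivAt ψ (ψ' x) x
  hasDerivAt' : ∀ x, HasDerivAt ψ' (((((x + a) ^ 2 - 3 : ℝ) : ℂ) - Complex.I) * ψ x) x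
  isBigO : ψ =O[atTop] fun x => Real.exp (-(1 / 2) * x)
  isBigO' : ψ' =O[atTop] fun x => Real.exp (-(1 / 2) * x)
  exists_ne_zero : ∀ X, ∃ x > X, ψ x ≠ 0

lemma isBigO_exp_neg_sq_mul {g : ℝ → ℂ} {n : ℕ} (hg : g =O[atTop] fun y : ℝ => y ^ n) (a : ℝ) :
    (fun x : ℝ => Complex.exp ((-(1 / 2) * (x + a) ^ 2 : ℝ) : ℂ) * g (x + a)) =O[atTop]
      fun x => Real.exp (-(1 / 2) * x) := by
  have h₁ : (fun y : ℝ => Complex.exp ((-(1 / 2) * y ^ 2 : ℝ) : ℂ)) =O[atTop]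
      fun y => Real.exp (-(1 / 2) * y ^ 2) :=
    Asymptotics.isBigO_of_le _ fun y => by
      rw [Complex.norm_exp_ofReal, Real.norm_of_nonneg (Real.exp_nonneg _)]
  have h₂ := (rpow_mul_exp_neg_mul_sq_isLittleO_exp_neg (b := 1 / 2) (by norm_num) n).isBigO
  have h₃ := (h₁.mul hg).trans
    (h₂.congr_left (f₂ := fun y : ℝ => Real.exp (-(1 / 2) * y ^ 2) * y ^ n)
      fun y => by rw [Real.rpow_natCast, mul_comm])
  refine (h₃.comp_tendsto (tendsto_atTop_add_const_right _ a tendsto_id)).trans ?_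
  refine Asymptotics.IsBigO.of_bound (Real.exp (-(1 / 2) * a)) (.of_forall fun x => ?_)
  simp only [Function.comp_apply, id_eq, Real.norm_eq_abs, Real.abs_exp, ← Real.exp_add]
  exact (congrArg Real.exp (by ring)).le

lemma IsHermiteSolution.hasDerivAt_gaussian_mul {v v' : ℝ → ℂ}
    (h : IsHermiteSolution (1 + Complex.I / 2) v v') (y : ℝ) :
    HasDerivAt (fun y : ℝ => Complex.exp ((-(1 / 2) * y ^ 2 : ℝ) : ℂ) * v y)
      (Complex.exp ((-(1 / 2) * y ^ 2 : ℝ) : ℂ) * (v' y - y * v y)) y ∧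
    HasDerivAt (fun y : ℝ => Complex.exp ((-(1 / 2) * y ^ 2 : ℝ) : ℂ) * (v' y - y * v y))
      ((((y ^ 2 - 3 : ℝ) : ℂ) - Complex.I) *
        (Complex.exp ((-(1 / 2) * y ^ 2 : ℝ) : ℂ) * v y)) y := by
  have hg : HasDerivAt (fun y : ℝ => Complex.exp ((-(1 / 2) * y ^ 2 : ℝ) : ℂ))
      (Complex.exp ((-(1 / 2) * y ^ 2 : ℝ) : ℂ) * ((-y : ℝ) : ℂ)) y := by
    have : HasDerivAt (fun y : ℝ => -(1 / 2) * y ^ 2) (-y) y :=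
      ((hasDerivAt_pow 2 y).const_mul (-(1 / 2) : ℝ)).congr_deriv (by norm_num; ring)
    exact this.ofReal_comp.cexp
  have hy : HasDerivAt (fun y : ℝ => (y : ℂ)) 1 y := by
    simpa using (hasDerivAt_id y).ofReal_comp
  constructor
  · refine (hg.mul (h.hasDerivAt y)).congr_deriv ?_
    push_cast
    ring
  · refine (hg.mul ((h.hasDerivAt' y).sub (hy.mul (h.hasDerivAt y)))).congr_deriv ?_
    simp only [Pi.sub_apply, Pi.mul_apply]
    push_cast
    ring

/-- The Gaussian times a Hermite function of order `1 + i/2` is a decaying solution. -/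
lemma exists_isDecayingSolution (a : ℝ) : ∃ ψ ψ' : ℝ → ℂ, IsDecayingSolution a ψ ψ' := by
  have h₀ := isHermiteSolution_hermiteMoment
  have h₁ := h₀.raise
  have h₂ := h₁.raise
  set v := hermiteMoment 0
  set s : ℝ → ℂ := fun y => 2 * y * v y - -2 * hermiteMoment 1 y
  set s' : ℝ → ℂ := fun y => 2 * (-1 + Complex.I / 2 + 1) * v y
  set r : ℝ → ℂ := fun y => 2 * y * s y - s' y
  set r' : ℝ → ℂ := fun y => 2 * (-1 + Complex.I / 2 + 1 + 1) * s y
  rw [show -1 + Complex.I / 2 + 1 + 1 = 1 + Complex.I / 2 by ring] at h₂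
  have hpow {m n : ℕ} (hmn : m ≤ n) : (fun y : ℝ => y ^ m) =O[atTop] fun y : ℝ => y ^ n :=
    Asymptotics.IsBigO.of_bound 1 <| by
      filter_upwards [eventually_ge_atTop 1] with y hy
      rw [norm_pow, norm_pow, one_mul]
      exact pow_le_pow_right₀ (hy.trans (le_abs_self y)) hmn
  have hid : (fun y : ℝ => (y : ℂ)) =O[atTop] fun y : ℝ => y ^ 1 :=
    Asymptotics.isBigO_of_le _ fun y => by simp
  have hmul {g : ℝ → ℂ} {n : ℕ} (hg : g =O[atTop] fun y : ℝ => y ^ n) :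
      (fun y : ℝ => (y : ℂ) * g y) =O[atTop] fun y : ℝ => y ^ (n + 1) :=
    (hid.mul hg).congr_right fun y => by ring
  have hM (k : ℕ) : hermiteMoment k =O[atTop] fun y : ℝ => y ^ 0 := by
    simpa using isBigO_hermiteMoment k
  have hsO : s =O[atTop] fun y : ℝ => y ^ 1 := by
    refine (((hmul (hM 0)).const_mul_left 2).congr_left fun y => ?_).sub
      (((hM 1).trans (hpow zero_le_one)).const_mul_left (-2))
    ring
  have hrO : r =O[atTop] fun y : ℝ => y ^ 2 := by
    refine (((hmul hsO).const_mul_left 2).congr_left fun y => ?_).sub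
      (((hM 0).trans (hpow zero_le_two)).const_mul_left _)
    ring
  have hrO' : (fun y => r' y - y * r y) =O[atTop] fun y : ℝ => y ^ 3 :=
    ((hsO.trans (hpow (by norm_num))).const_mul_left _).sub (hmul hrO)
  refine ⟨fun x => Complex.exp ((-(1 / 2) * (x + a) ^ 2 : ℝ) : ℂ) * r (x + a),
    fun x => Complex.exp ((-(1 / 2) * (x + a) ^ 2 : ℝ) : ℂ) *
      (r' (x + a) - ((x + a : ℝ) : ℂ) * r (x + a)),
    fun x => (h₂.hasDerivAt_gaussian_mul (x + a)).1.comp_add_const x a,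
    fun x => (h₂.hasDerivAt_gaussian_mul (x + a)).2.comp_add_const x a,
    isBigO_exp_neg_sq_mul hrO a, isBigO_exp_neg_sq_mul hrO' a, fun X => ?_⟩
  by_contra! hX
  have hr0 : EqOn r 0 (Ioi (X + a)) := fun y hy => by
    have hy' : X + a < y := hy
    simpa using hX (y - a) (by linarith)
  have hv0 : EqOn v 0 (Ioi (X + a)) := by
    refine h₀.eqOn_zero_of_raise (by simp) (h₁.eqOn_zero_of_raise (fun h => ?_) hr0)
    simpa using congrArg Complex.re h
  have hb : max (X + a) 0 + 1 ∈ Ioi (X + a) := by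
    have := le_max_left (X + a) 0
    exact mem_Ioi.2 (by linarith)
  exact hermiteMoment_zero_zero_ne_zero
    (h₀.apply_zero_eq_zero (by positivity) (hv0 hb) (h₀.deriv_eqOn_zero hv0 hb))

namespace IsDecayingSolution

variable {a : ℝ} {ψ ψ' : ℝ → ℂ}

lemma tendsto_exp_neg_half_mul :
    Tendsto (fun x : ℝ => Real.exp (-(1 / 2) * x)) atTop (𝓝 0) :=
  Real.tendsto_exp_atBot.comp (tendsto_id.const_mul_atTop_of_neg (by norm_num))

lemma continuous (h : IsDecayingSolution a ψ ψ') : Continuous ψ :=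
  continuous_iff_continuousAt.2 fun x => (h.hasDerivAt x).continuousAt

lemma continuous' (h : IsDecayingSolution a ψ ψ') : Continuous ψ' :=
  continuous_iff_continuousAt.2 fun x => (h.hasDerivAt' x).continuousAt

lemma tendsto (h : IsDecayingSolution a ψ ψ') : Tendsto ψ atTop (𝓝 0) :=
  h.isBigO.trans_tendsto tendsto_exp_neg_half_mul

lemma tendsto' (h : IsDecayingSolution a ψ ψ') : Tendsto ψ' atTop (𝓝 0) :=
  h.isBigO'.trans_tendsto tendsto_exp_neg_half_mul

lemma integrableOn_norm_sq {g : ℝ → ℂ} (hg : Continuous g)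
    (hO : g =O[atTop] fun x => Real.exp (-(1 / 2) * x)) :
    IntegrableOn (fun x => ‖g x‖ ^ 2) (Ioi 0) := by
  refine integrable_of_isBigO_exp_neg one_pos (by fun_prop) ((hO.norm_left.pow 2).congr_right ?_)
  intro x
  rw [← Real.exp_nat_mul]
  congr 1
  push_cast
  ring

lemma contDiff (h : IsDecayingSolution a ψ ψ') : ContDiff ℝ 2 ψ := by
  have e : deriv ψ = ψ' := funext fun x => (h.hasDerivAt x).deriv
  have e' : deriv ψ' = fun x : ℝ => ((((x + a) ^ 2 - 3 : ℝ) : ℂ) - Complex.I) * ψ x :=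
    funext fun x => (h.hasDerivAt' x).deriv
  have hc := h.continuous
  rw [show (2 : WithTop ℕ∞) = 1 + 1 by norm_num, contDiff_succ_iff_deriv, e]
  refine ⟨fun x => (h.hasDerivAt x).differentiableAt, by simp, ?_⟩
  rw [contDiff_one_iff_deriv, e']
  exact ⟨fun x => (h.hasDerivAt' x).differentiableAt, by fun_prop⟩

/-- The imaginary part of `conj ψ * ψ'` is strictly decreasing where `ψ ≠ 0`. -/
lemma hasDerivAt_im (h : IsDecayingSolution a ψ ψ') (x : ℝ) :
    HasDerivAt (fun x => (ψ x).re * (ψ' x).im - (ψ x).im * (ψ' x).re)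
      (-((ψ x).re ^ 2 + (ψ x).im ^ 2)) x := by
  have hre {g : ℝ → ℂ} {g' : ℂ} (hg : HasDerivAt g g' x) :
      HasDerivAt (fun x => (g x).re) g'.re x :=
    Complex.reCLM.hasFDerivAt.comp_hasDerivAt x hg
  have him {g : ℝ → ℂ} {g' : ℂ} (hg : HasDerivAt g g' x) :
      HasDerivAt (fun x => (g x).im) g'.im x :=
    Complex.imCLM.hasFDerivAt.comp_hasDerivAt x hg
  refine (((hre (h.hasDerivAt x)).mul (him (h.hasDerivAt' x))).sub
    ((him (h.hasDerivAt x)).mul (hre (h.hasDerivAt' x)))).congr_deriv ?_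
  simp only [Complex.mul_re, Complex.mul_im, Complex.sub_re, Complex.sub_im, Complex.ofReal_re,
    Complex.ofReal_im, Complex.I_re, Complex.I_im]
  ring

lemma apply_ne_zero (h : IsDecayingSolution a ψ ψ') (x₀ : ℝ) : ψ x₀ ≠ 0 := by
  intro h0
  set P : ℝ → ℝ := fun x => (ψ x).re * (ψ' x).im - (ψ x).im * (ψ' x).re with hP
  have hanti : Antitone P :=
    antitone_of_deriv_nonpos (fun x => (h.hasDerivAt_im x).differentiableAt) fun x => by
      rw [(h.hasDerivAt_im x).deriv]
      nlinarith [sq_nonneg (ψ x).re, sq_nonneg (ψ x).im]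
  have hlim : Tendsto P atTop (𝓝 0) := by
    have hre {g : ℝ → ℂ} (hg : Tendsto g atTop (𝓝 0)) :
        Tendsto (fun x => (g x).re) atTop (𝓝 0) :=
      (Complex.continuous_re.tendsto 0).comp hg
    have him {g : ℝ → ℂ} (hg : Tendsto g atTop (𝓝 0)) :
        Tendsto (fun x => (g x).im) atTop (𝓝 0) :=
      (Complex.continuous_im.tendsto 0).comp hg
    simpa using ((hre h.tendsto).mul (him h.tendsto')).sub ((him h.tendsto).mul (hre h.tendsto'))
  have hP0 : ∀ x ∈ Ioi x₀, P x = 0 := fun x hx =>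
    le_antisymm ((hanti (le_of_lt hx)).trans_eq (by simp [hP, h0])) (hanti.le_of_tendsto hlim x)
  obtain ⟨x, hx, hne⟩ := h.exists_ne_zero x₀
  have hd := (h.hasDerivAt_im x).unique ((hasDerivAt_const x (0 : ℝ)).congr_of_eventuallyEq
    (eventually_of_mem (Ioi_mem_nhds hx) hP0))
  refine hne (Complex.ext ?_ ?_) <;>
    simp only [Complex.zero_re, Complex.zero_im] <;>
    nlinarith [sq_nonneg (ψ x).re, sq_nonneg (ψ x).im]

/-- Every square-integrable solution on the half-line is a multiple of the decaying one. -/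
lemma exists_eq_mul (h : IsDecayingSolution a ψ ψ') {f f' : ℝ → ℂ}
    (hf : ∀ x ∈ Ioi (0 : ℝ), HasDerivAt f (f' x) x)
    (hf' : ∀ x ∈ Ioi (0 : ℝ),
      HasDerivAt f' (((((x + a) ^ 2 - 3 : ℝ) : ℂ) - Complex.I) * f x) x)
    (hInt : IntegrableOn (fun x => ‖f x‖ ^ 2) (Ioi 0)) :
    ∃ c : ℂ, ∀ x ∈ Ioi (0 : ℝ), f x = c * ψ x := by
  have hW : ∀ x ∈ Ioi (0 : ℝ), HasDerivAt (fun x => f x * ψ' x - f' x * ψ x) 0 x := fun x hx =>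
    (((hf x hx).mul (h.hasDerivAt' x)).sub ((hf' x hx).mul (h.hasDerivAt x))).congr_deriv (by ring)
  obtain ⟨W, hWc⟩ := isOpen_Ioi.exists_is_const_of_deriv_eq_zero isPreconnected_Ioi
    (fun x hx => (hW x hx).differentiableAt.differentiableWithinAt) fun x hx => (hW x hx).deriv
  have hfm : AEStronglyMeasurable f (volume.restrict (Ioi 0)) :=
    ContinuousOn.aestronglyMeasurable
      (fun x hx => (hf x hx).continuousAt.continuousWithinAt) measurableSet_Ioi
  have hmul {g : ℝ → ℂ} (hg : Continuous g)
      (hO : g =O[atTop] fun x => Real.exp (-(1 / 2) * x)) :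
      IntegrableOn (fun x => f x * g x) (Ioi 0) := by
    refine (hInt.add (integrableOn_norm_sq hg hO)).mono' (hfm.mul hg.aestronglyMeasurable)
      (.of_forall fun x => ?_)
    rw [norm_mul, Pi.add_apply]
    nlinarith [sq_nonneg (‖f x‖ - ‖g x‖), sq_nonneg ‖f x‖, sq_nonneg ‖g x‖]
  have hW0 : W = 0 := by
    by_contra hne
    have hd : ∀ x ∈ Ioi (0 : ℝ),
        HasDerivAt (fun x : ℝ => f x * ψ x + W * x) (2 * (f x * ψ' x)) x := fun x hx => by
      have hx' : HasDerivAt (fun x : ℝ => W * (x : ℂ)) W x := by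
        simpa using (hasDerivAt_id x).ofReal_comp.const_mul W
      refine (((hf x hx).mul (h.hasDerivAt x)).add hx').congr_deriv ?_
      rw [← hWc x hx]
      ring
    obtain ⟨L, hlim⟩ : ∃ L, Tendsto (fun x : ℝ => f x * ψ x + W * x) atTop (𝓝 L) :=
      ⟨_, tendsto_limUnder_of_hasDerivAt_of_integrableOn_Ioi hd
        ((hmul h.continuous' h.isBigO').const_mul 2)⟩
    have hlarge : Tendsto (fun x : ℝ => ‖W * x‖) atTop atTop := by
      simp only [norm_mul, Complex.norm_real]
      exact tendsto_norm_atTop_atTop.const_mul_atTop (norm_pos_iff.2 hne)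
    obtain ⟨X, hX⟩ := ((hlarge.eventually_ge_atTop (‖L‖ + 1 + 1)).and
      (hlim.norm.eventually_le_const (lt_add_one _))).exists_forall_of_atTop
    have hone : IntegrableOn (fun _ : ℝ => (1 : ℝ)) (Ioi (max X 0)) := by
      refine ((hmul h.continuous h.isBigO).mono_set
        (Ioi_subset_Ioi (le_max_right X 0))).norm.mono' aestronglyMeasurable_const ?_
      filter_upwards [ae_restrict_mem measurableSet_Ioi] with x hx
      obtain ⟨h₁, h₂⟩ := hX x ((le_max_left X 0).trans (le_of_lt hx))
      have h₃ := norm_sub_le (f x * ψ x + W * x) (f x * ψ x)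
      rw [add_sub_cancel_left] at h₃
      rw [norm_one]
      linarith
    simp [integrableOn_const_iff] at hone
  have hq : ∀ x ∈ Ioi (0 : ℝ), HasDerivAt (fun x => f x / ψ x) 0 x := fun x hx => by
    refine ((hf x hx).div (h.hasDerivAt x) (h.apply_ne_zero x)).congr_deriv ?_
    have := hWc x hx
    rw [show f' x * ψ x - f x * ψ' x = 0 by linear_combination -this - hW0,
      zero_div]
  obtain ⟨c, hc⟩ := isOpen_Ioi.exists_is_const_of_deriv_eq_zero isPreconnected_Ioi
    (fun x hx => (hq x hx).differentiableAt.differentiableWithinAt) fun x hx => (hq x hx).deriv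
  exact ⟨c, fun x hx => (div_eq_iff (h.apply_ne_zero x)).1 (hc x hx)⟩

/-- The even extension of `ψ` from the half-line and its derivatives off the origin. -/
lemma hasDerivAt_comp_abs (h : IsDecayingSolution a ψ ψ') {x : ℝ} (hx : x ≠ 0) :
    HasDerivAt (fun x => ψ |x|) ((SignType.sign x : ℝ) • ψ' |x|) x ∧
    HasDerivAt (fun x => (SignType.sign x : ℝ) • ψ' |x|)
      (((((|x| + a) ^ 2 - 3 : ℝ) : ℂ) - Complex.I) * ψ |x|) x := by
  refine ⟨(h.hasDerivAt |x|).scomp x (hasDerivAt_abs hx), ?_⟩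
  have hd := ((h.hasDerivAt' |x|).scomp x (hasDerivAt_abs hx)).const_smul (SignType.sign x : ℝ)
  have hs : (SignType.sign x : ℝ) * (SignType.sign x : ℝ) = 1 := by
    rcases hx.lt_or_gt with hx | hx <;> simp [hx]
  rw [smul_smul, hs, one_smul] at hd
  refine hd.congr_of_eventuallyEq ?_
  rcases hx.lt_or_gt with hx | hx
  · filter_upwards [Iio_mem_nhds hx] with y hy
    simp [sign_neg hx, sign_neg (mem_Iio.1 hy)]
  · filter_upwards [Ioi_mem_nhds hx] with y hy
    simp [sign_pos hx, sign_pos (mem_Ioi.1 hy)]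

end IsDecayingSolution

lemma integrable_comp_abs {g : ℝ → ℝ} (hg : IntegrableOn g (Ioi 0)) :
    Integrable fun x => g |x| := by
  have h₁ : IntegrableOn (fun x => g |x|) (Ioi 0) :=
    hg.congr_fun (fun x hx => by rw [abs_of_pos hx]) measurableSet_Ioi
  have h₂ : IntegrableOn (fun x => g |x|) (Iio 0) := by
    have := ((Measure.measurePreserving_neg (volume : Measure ℝ)).integrableOn_comp_preimage
      (Homeomorph.neg ℝ).measurableEmbedding).2 h₁
    simpa [Function.comp_def] using this
  rw [← integrableOn_univ, ← Iic_union_Ioi (a := (0 : ℝ)), integrableOn_union,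
    integrableOn_Iic_iff_integrableOn_Iio]
  exact ⟨h₂, h₁⟩

/-- Deficiency-index computation: for any `γ ∈ ℝ`, the space of functions `u : ℝ → ℂ`
that are continuous on `ℝ`, `C²` on `ℝ \ {0}`, square-integrable, and satisfy
`-u'' + ((|x|+γ/2)² - 3)u = i·u` for `x ≠ 0`, is a one-dimensional complex vector space:
it is the span of a single nonzero solution. -/
theorem stmt13 (γ : ℝ) :
    ∃ u₀ : ℝ → ℂ, u₀ ≠ 0 ∧
      ∀ u : ℝ → ℂ,
        (Continuous u ∧ ContDiffOn ℝ 2 u {0}ᶜ ∧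
          Integrable (fun x => ‖u x‖ ^ 2) ∧
          ∀ x ≠ 0, -(deriv (deriv u) x) + (((|x| + γ / 2) ^ 2 - 3 : ℝ) : ℂ) * u x
            = Complex.I * u x)
        ↔ ∃ c : ℂ, u = c • u₀ := by
  obtain ⟨ψ, ψ', h⟩ := exists_isDecayingSolution (γ / 2)
  refine ⟨fun x => ψ |x|, fun h0 => h.apply_ne_zero |0| (congrFun h0 0), fun u => ⟨?_, ?_⟩⟩
  · rintro ⟨hc, hd, hi, he⟩
    have hnhds {x : ℝ} (hx : x ≠ 0) : ({0}ᶜ : Set ℝ) ∈ 𝓝 x := isOpen_compl_singleton.mem_nhds hx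
    have hu {x : ℝ} (hx : x ≠ 0) : HasDerivAt u (deriv u x) x :=
      ((hd.contDiffAt (hnhds hx)).differentiableAt two_ne_zero).hasDerivAt
    have hu' {x : ℝ} (hx : x ≠ 0) : HasDerivAt (deriv u)
        (((((|x| + γ / 2) ^ 2 - 3 : ℝ) : ℂ) - Complex.I) * u x) x := by
      have hd' : ContDiffOn ℝ 1 (deriv u) {0}ᶜ :=
        hd.deriv_of_isOpen isOpen_compl_singleton (by norm_num)
      refine ((hd'.contDiffAt (hnhds hx)).differentiableAt one_ne_zero).hasDerivAt.congr_deriv ?_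
      linear_combination -he x hx
    obtain ⟨c, hpos⟩ := h.exists_eq_mul (fun x hx => hu (ne_of_gt hx))
      (fun x hx => by simpa only [abs_of_pos (mem_Ioi.1 hx)] using hu' (ne_of_gt hx))
      hi.integrableOn
    obtain ⟨d, hneg⟩ := h.exists_eq_mul (f := fun x => u (-x)) (f' := fun x => -deriv u (-x))
      (fun x hx => by
        exact ((hu (neg_ne_zero.2 (ne_of_gt hx))).scomp x (hasDerivAt_neg x)).congr_deriv
          (by simp))
      (fun x hx => by
        have := ((hu' (neg_ne_zero.2 (ne_of_gt hx))).scomp x (hasDerivAt_neg x)).neg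
        simp only [abs_neg, abs_of_pos (mem_Ioi.1 hx)] at this
        exact this.congr_deriv (by simp))
      hi.comp_neg.integrableOn
    have hlim {f : ℝ → ℂ} {c : ℂ} (hf : Continuous f) (hfc : ∀ x ∈ Ioi (0 : ℝ), f x = c * ψ x) :
        f 0 = c * ψ 0 := by
      have h₁ : Tendsto f (𝓝[>] 0) (𝓝 (f 0)) := hf.continuousWithinAt
      have h₂ : Tendsto (fun x => c * ψ x) (𝓝[>] 0) (𝓝 (c * ψ 0)) :=
        (continuous_const.mul h.continuous).continuousWithinAt
      exact tendsto_nhds_unique h₁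
        (h₂.congr' (eventually_of_mem self_mem_nhdsWithin fun x hx => (hfc x hx).symm))
    have hc0 := hlim hc hpos
    have hd0 := hlim (hc.comp continuous_neg) hneg
    have hcd : c = d := by
      refine mul_right_cancel₀ (h.apply_ne_zero 0) ?_
      rw [← hc0, ← hd0]
      simp
    refine ⟨c, funext fun x => ?_⟩
    rcases lt_trichotomy x 0 with hx | rfl | hx
    · simpa [abs_of_neg hx, hcd] using hneg (-x) (neg_pos.2 hx)
    · simpa using hc0
    · simpa [abs_of_pos hx] using hpos x hx
  · rintro ⟨c, rfl⟩
    refine ⟨(h.continuous.comp continuous_abs).const_smul c, fun x hx => ?_, ?_, fun x hx => ?_⟩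
    · exact ((h.contDiff.contDiffAt.comp x (contDiffAt_abs hx)).const_smul c).contDiffWithinAt
    · simpa [mul_pow] using (integrable_comp_abs
        (IsDecayingSolution.integrableOn_norm_sq h.continuous h.isBigO)).const_mul (‖c‖ ^ 2)
    · have e : deriv (c • fun x => ψ |x|) =ᶠ[𝓝 x]
          c • fun x => (SignType.sign x : ℝ) • ψ' |x| := by
        filter_upwards [isOpen_compl_singleton.mem_nhds hx] with y hy
        exact ((h.hasDerivAt_comp_abs hy).1.const_smul c).deriv
      rw [e.deriv_eq, ((h.hasDerivAt_comp_abs hx).2.const_smul c).deriv]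
      simp only [Pi.smul_apply, smul_eq_mul]
      ring
end
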